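/- arXiv:0705.1874 — 5 statements merged into one kernel-verified Lean document; each statement's English description precedes it below -/
import Mathlib

section
/- Let K be an irreducible kernel on a countable set X with all convolution powers finite. Then the value limsup_{n→∞} (k^(n)(x,y))^{1/n} is the same for all x, y ∈ X; denoting this common value by ρ(K), one has ρ(K) > 0, and the common radius of convergence R(K) of the Green functions G(x,y|·) satisfies R(K) = 1/ρ(K) < ∞. -/
open Filter
open scoped ENNReal NNReal

/-- Convolution powers of a kernel: `k^(0)(x,y) = 1` if `x = y` and `0` otherwise, and
`k^(n+1)(x,y) = Σ_z k^(n)(x,z) * k(z,y)`. -/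
noncomputable def kpow {X : Type*} [DecidableEq X] (k : X → X → ℝ≥0∞) : ℕ → X → X → ℝ≥0∞
  | 0 => fun x y => if x = y then 1 else 0
  | n + 1 => fun x y => ∑' z, kpow k n x z * k z y

/-- A kernel is irreducible if for all `x, y` there is `l ≥ 1` with `k^(l)(x,y) > 0`. -/
def KIrred {X : Type*} [DecidableEq X] (k : X → X → ℝ≥0∞) : Prop :=
  ∀ x y, ∃ l, 1 ≤ l ∧ 0 < kpow k l x y

/-- The Green function `G(x,y|z) = Σ_n k^(n)(x,y) * zⁿ`. -/
noncomputable def green {X : Type*} [DecidableEq X] (k : X → X → ℝ≥0∞) (x y : X)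
    (z : ℝ≥0∞) : ℝ≥0∞ :=
  ∑' n, kpow k n x y * z ^ n

/-- The radius of convergence of the Green function `G(x,y|·)`: the supremum of the set of
`z` at which the series converges (is finite). -/
noncomputable def convRadius {X : Type*} [DecidableEq X] (k : X → X → ℝ≥0∞) (x y : X) : ℝ≥0∞ :=
  sSup {z : ℝ≥0∞ | green k x y z ≠ ⊤}

/-- `limsup_n (k^(n)(x,y))^{1/n}`. -/
noncomputable def rhoAt {X : Type*} [DecidableEq X] (k : X → X → ℝ≥0∞) (x y : X) : ℝ≥0∞ :=
  Filter.limsup (fun n : ℕ => (kpow k n x y) ^ (1 / (n : ℝ))) Filter.atTop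

lemma sSup_tsum_mul_pow_ne_top_eq_inv_limsup (a : ℕ → ℝ≥0∞) (ha : ∀ n, a n ≠ ⊤) :
    sSup {z : ℝ≥0∞ | ∑' n, a n * z ^ n ≠ ⊤} =
      (limsup (fun n : ℕ => a n ^ (1 / (n : ℝ))) atTop)⁻¹ := by
  apply le_antisymm
  · refine sSup_le fun z hz => ?_
    rw [ENNReal.le_inv_iff_le_inv]
    refine limsup_le_of_le (h := ?_)
    have hlim := ENNReal.tendsto_atTop_zero_of_tsum_ne_top hz
    filter_upwards [hlim.eventually (ge_mem_nhds zero_lt_one), eventually_gt_atTop 0]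
      with n hn hn0
    have hn0' : n ≠ 0 := hn0.ne'
    rw [ENNReal.le_inv_iff_mul_le, one_div]
    have h := ENNReal.rpow_le_rpow hn (inv_nonneg.2 (Nat.cast_nonneg (α := ℝ) n))
    rwa [ENNReal.mul_rpow_of_nonneg _ _ (by positivity), ENNReal.one_rpow,
      ENNReal.pow_rpow_inv_natCast hn0'] at h
  · refine le_of_forall_lt fun z hz => ?_
    obtain ⟨w, hzw, hw⟩ := exists_between hz
    refine hzw.trans_le (le_sSup ?_)
    have hwt : w ≠ ⊤ := hw.ne_top
    rw [ENNReal.lt_inv_iff_lt_inv] at hw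
    obtain ⟨q, hLq, hq⟩ := exists_between hw
    obtain ⟨N, hN⟩ := eventually_atTop.1 (eventually_lt_of_limsup_lt hLq)
    have hqw : q * w < 1 := by
      rw [mul_comm]
      exact ENNReal.mul_lt_of_lt_div' (by simpa using hq)
    have hle : ∀ n, a (n + (N + 1)) * w ^ (n + (N + 1)) ≤ (q * w) ^ n := by
      intro n
      have h := ENNReal.rpow_le_rpow (hN (n + (N + 1)) (by omega)).le
        (Nat.cast_nonneg (α := ℝ) (n + (N + 1)))
      rw [one_div, ENNReal.rpow_natCast, ENNReal.rpow_natCast,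
        ENNReal.rpow_inv_natCast_pow (by omega)] at h
      calc _ ≤ q ^ (n + (N + 1)) * w ^ (n + (N + 1)) := by gcongr
        _ = (q * w) ^ (n + (N + 1)) := (mul_pow _ _ _).symm
        _ ≤ (q * w) ^ n := pow_le_pow_right_of_le_one' hqw.le (by omega)
    rw [Set.mem_ofPred_eq, ← Summable.sum_add_tsum_nat_add' (k := N + 1) ENNReal.summable]
    refine ENNReal.add_ne_top.2 ⟨?_, ?_⟩
    · exact ENNReal.sum_ne_top.2 fun n _ => ENNReal.mul_ne_top (ha n) (ENNReal.pow_ne_top hwt)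
    · refine ne_top_of_le_ne_top ?_ (ENNReal.tsum_le_tsum hle)
      rw [ENNReal.tsum_geometric]
      exact ENNReal.inv_ne_top.2 (tsub_pos_of_lt hqw).ne'

section KernelPowers

variable {X : Type*} [DecidableEq X] (k : X → X → ℝ≥0∞)

lemma kpow_mul_kpow_le (m n : ℕ) (x z y : X) :
    kpow k m x z * kpow k n z y ≤ kpow k (m + n) x y := by
  induction n generalizing y with
  | zero =>
    by_cases h : z = y
    · subst h; simp [kpow]
    · simp [kpow, h]
  | succ n ih =>
    rw [← add_assoc]
    simp only [kpow]
    rw [← ENNReal.tsum_mul_left]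
    refine ENNReal.tsum_le_tsum fun w => ?_
    rw [← mul_assoc]
    gcongr
    exact ih w

lemma kpow_pow_le (l m : ℕ) (x : X) : kpow k l x x ^ m ≤ kpow k (l * m) x x := by
  induction m with
  | zero => simp [kpow]
  | succ m ih =>
    rw [pow_succ, mul_add_one]
    exact (mul_le_mul_left ih _).trans (kpow_mul_kpow_le k _ _ x x x)

lemma green_zero_ne_top (x y : X) : green k x y 0 ≠ ⊤ := by
  rw [green, tsum_eq_single 0 (fun n hn => by simp [hn])]
  simp only [kpow]
  split_ifs <;> simp

variable {k}

lemma green_ne_top_of_ne_top (hirr : KIrred k) {x y : X} (x' y' : X) {z : ℝ≥0∞}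
    (hz : green k x y z ≠ ⊤) : green k x' y' z ≠ ⊤ := by
  rcases eq_or_ne z 0 with rfl | hz0
  · exact green_zero_ne_top k x' y'
  obtain ⟨l, -, hl⟩ := hirr x x'
  obtain ⟨m, -, hm⟩ := hirr y' y
  have hle : kpow k l x x' * kpow k m y' y * z ^ (l + m) * green k x' y' z ≤ green k x y z := by
    rw [green, ← ENNReal.tsum_mul_left]
    calc _ ≤ ∑' n, kpow k (n + (l + m)) x y * z ^ (n + (l + m)) := by
          refine ENNReal.tsum_le_tsum fun n => ?_
          have h : kpow k l x x' * kpow k n x' y' * kpow k m y' y ≤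
              kpow k (n + (l + m)) x y := by
            rw [show n + (l + m) = l + n + m by omega]
            exact (mul_le_mul_left (kpow_mul_kpow_le k l n x x' y') _).trans
              (kpow_mul_kpow_le k (l + n) m x y' y)
          calc _ = kpow k l x x' * kpow k n x' y' * kpow k m y' y * z ^ (n + (l + m)) := by
                rw [pow_add z n]; ring
            _ ≤ _ := by gcongr
      _ ≤ _ := ENNReal.tsum_comp_le_tsum_of_injective (add_left_injective (l + m))
          (fun n => kpow k n x y * z ^ n)
  intro htop
  rw [htop, ENNReal.mul_top (mul_ne_zero (mul_ne_zero hl.ne' hm.ne') (pow_ne_zero _ hz0))] at hle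
  exact hz (top_le_iff.1 hle)

lemma convRadius_eq_of_irred (hirr : KIrred k) (x y x' y' : X) :
    convRadius k x y = convRadius k x' y' := by
  unfold convRadius
  congr 1
  ext z
  exact ⟨green_ne_top_of_ne_top hirr x' y', green_ne_top_of_ne_top hirr x y⟩

lemma convRadius_eq_inv_rhoAt (hfin : ∀ n x y, kpow k n x y ≠ ⊤) (x y : X) :
    convRadius k x y = (rhoAt k x y)⁻¹ :=
  sSup_tsum_mul_pow_ne_top_eq_inv_limsup _ fun n => hfin n x y

lemma mul_pow_le_one_of_green_ne_top {l : ℕ} (hl : 1 ≤ l) {x : X} {z : ℝ≥0∞}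
    (hz : green k x x z ≠ ⊤) : kpow k l x x * z ^ l ≤ 1 := by
  by_contra! h
  have hlim := ENNReal.tendsto_atTop_zero_of_tsum_ne_top hz
  obtain ⟨N, hN⟩ := eventually_atTop.1 (hlim.eventually (gt_mem_nhds zero_lt_one))
  refine absurd (hN (l * N) (Nat.le_mul_of_pos_left N hl)) (not_lt.2 ?_)
  calc 1 ≤ (kpow k l x x * z ^ l) ^ N := one_le_pow_of_one_le' h.le N
    _ = kpow k l x x ^ N * z ^ (l * N) := by rw [mul_pow, pow_mul]
    _ ≤ _ := mul_le_mul_left (kpow_pow_le k l N x) _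

lemma convRadius_self_lt_top (hirr : KIrred k) (x : X) : convRadius k x x < ⊤ := by
  obtain ⟨l, hl, hpos⟩ := hirr x x
  refine lt_of_le_of_lt (b := (kpow k l x x)⁻¹ ^ ((l : ℝ)⁻¹)) (sSup_le fun z hz => ?_)
    (ENNReal.rpow_lt_top_of_nonneg (by positivity) (ENNReal.inv_ne_top.2 hpos.ne'))
  have h := mul_pow_le_one_of_green_ne_top hl hz
  rw [mul_comm, ← ENNReal.le_inv_iff_mul_le] at h
  calc z = (z ^ l) ^ ((l : ℝ)⁻¹) := (ENNReal.pow_rpow_inv_natCast (by omega) z).symm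
    _ ≤ _ := ENNReal.rpow_le_rpow h (by positivity)

end KernelPowers

/-- For an irreducible kernel with finite convolution powers, the value
`limsup (k^(n)(x,y))^{1/n}` is the same positive constant `ρ` for all `x, y`, and the common
radius of convergence `R(K)` of the Green functions satisfies `R(K) = 1/ρ < ∞`. -/
theorem spectral_radius_wellDefined {X : Type*} [Countable X] [DecidableEq X] (k : X → X → ℝ≥0∞)
    (hfin : ∀ n x y, kpow k n x y ≠ ⊤) (hirr : KIrred k) :
    ∃ ρ : ℝ≥0∞, 0 < ρ ∧ (∀ x y : X, rhoAt k x y = ρ) ∧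
      (∀ x y : X, convRadius k x y = 1 / ρ) ∧ 1 / ρ < ⊤ := by
  rcases isEmpty_or_nonempty X with hX | ⟨⟨o⟩⟩
  · exact ⟨1, one_pos, fun x => hX.elim x, fun x => hX.elim x, by simp⟩
  have hrad (x y : X) : convRadius k x y = (rhoAt k o o)⁻¹ := by
    rw [convRadius_eq_of_irred hirr x y o o, convRadius_eq_inv_rhoAt hfin]
  have htop : (rhoAt k o o)⁻¹ < ⊤ := hrad o o ▸ convRadius_self_lt_top hirr o
  refine ⟨rhoAt k o o, ENNReal.inv_lt_top.1 htop, fun x y => ?_, fun x y => ?_, ?_⟩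
  · rw [← inv_inj, ← convRadius_eq_inv_rhoAt hfin, hrad]
  · rw [one_div, hrad]
  · rwa [one_div]
end

section
/- Let K be an irreducible kernel on a countable set X with all convolution powers finite, and let t > 0. If there exists a function f : X → (0,∞) such that Σ_{y∈X} k(x,y) f(y) ≤ t · f(x) for all x ∈ X (in particular the sum converges), then ρ(K) ≤ t. -/
open Filter
open scoped ENNReal NNReal

/-- Iterating superharmonicity: if `K f ≤ t f` then `Kⁿ f ≤ tⁿ f`. -/
theorem tsum_kpow_mul_le {X : Type*} [DecidableEq X] {k : X → X → ℝ≥0∞} {t : ℝ≥0∞}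
    {f : X → ℝ≥0∞} (hsh : ∀ x, ∑' y, k x y * f y ≤ t * f x) (n : ℕ) (x : X) :
    ∑' y, kpow k n x y * f y ≤ t ^ n * f x := by
  induction n with
  | zero =>
    rw [tsum_eq_single x fun y hy => by simp [kpow, hy.symm]]
    simp [kpow]
  | succ n ih =>
    calc ∑' y, kpow k (n + 1) x y * f y
        = ∑' z, kpow k n x z * ∑' y, k z y * f y := by
          simp only [kpow, ← ENNReal.tsum_mul_right, ← ENNReal.tsum_mul_left]
          rw [ENNReal.tsum_comm]
          simp only [mul_assoc]
      _ ≤ ∑' z, kpow k n x z * (t * f z) := by gcongr; exact hsh _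
      _ = t * ∑' z, kpow k n x z * f z := by
          simp only [← ENNReal.tsum_mul_left, mul_left_comm]
      _ ≤ t * (t ^ n * f x) := by gcongr
      _ = t ^ (n + 1) * f x := by ring

/-- The diagonal of the `n`-th convolution power is at most `tⁿ`. -/
theorem kpow_self_le_pow {X : Type*} [DecidableEq X] {k : X → X → ℝ≥0∞} {t : ℝ≥0∞}
    {f : X → ℝ≥0∞} (hsh : ∀ x, ∑' y, k x y * f y ≤ t * f x) (n : ℕ) {x : X}
    (h0 : f x ≠ 0) (htop : f x ≠ ⊤) : kpow k n x x ≤ t ^ n :=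
  (ENNReal.mul_le_mul_iff_left h0 htop).1 <|
    (ENNReal.le_tsum x).trans (tsum_kpow_mul_le hsh n x)

/-- If an irreducible kernel with finite convolution powers admits a positive `t`-superharmonic
function `f`, i.e. `Σ_y k(x,y) f(y) ≤ t * f(x)` for all `x`, then `ρ(K) ≤ t`. -/
theorem rho_le_of_superharmonic {X : Type*} [Countable X] [DecidableEq X] (k : X → X → ℝ≥0∞)
    (hfin : ∀ n x y, kpow k n x y ≠ ⊤) (hirr : KIrred k)
    (t : ℝ≥0∞) (ht : 0 < t) (ht' : t ≠ ⊤)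
    (f : X → ℝ≥0∞) (hf : ∀ x, 0 < f x ∧ f x ≠ ⊤)
    (hsh : ∀ x, ∑' y, k x y * f y ≤ t * f x) :
    ∀ x : X, rhoAt k x x ≤ t := by
  intro x
  refine limsup_le_of_le (by isBoundedDefault) ?_
  filter_upwards [eventually_ne_atTop 0] with n hn
  calc kpow k n x x ^ (1 / (n : ℝ))
      ≤ (t ^ n) ^ (1 / (n : ℝ)) := by
        gcongr
        exact kpow_self_le_pow hsh n (hf x).1.ne' (hf x).2
    _ = t := by rw [one_div, ENNReal.pow_rpow_inv_natCast hn]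
end

section
/- Let d ≥ 1, let U ⊂ ℤ^d be a finite set, and let m : U → [0,∞) be such that m(s) > 0 for every s in some subset S ⊆ U that generates ℤ^d as a group. Let M^h_m be the homogeneous kernel on ℤ^d given by m(x, x+s) = m(s) for s ∈ U and 0 otherwise. Then ρ(M^h_m) := limsup_{n→∞} ((m^h)^(n)(0,0))^{1/n} = inf_{θ∈ℝ^d} Σ_{s∈U} e^{⟨θ,s⟩} m(s). -/
open Filter
open scoped ENNReal NNReal

/-- The lattice `ℤ^d`. -/
abbrev Zd (d : ℕ) := Fin d → ℤ

/-- The kernel `M_σ` on `ℤ^d` associated to an environment `σ = (σ_x)_{x ∈ ℤ^d}`,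
`σ_x : U → [0,∞)`: `m_σ(x, x+s) = σ_x(s)` for `s ∈ U` and `m_σ(x,y) = 0` if `y - x ∉ U`. -/
noncomputable def mker {d : ℕ} (U : Finset (Zd d)) (σ : Zd d → (↥U → ℝ)) :
    Zd d → Zd d → ℝ≥0∞ :=
  fun x y => if h : y - x ∈ U then ENNReal.ofReal (σ x ⟨y - x, h⟩) else 0

/-- The standard inner product `⟨θ, s⟩` on `ℝ^d`, with `ℤ^d` embedded in `ℝ^d`. -/
def zdot {d : ℕ} (θ : Fin d → ℝ) (s : Zd d) : ℝ := ∑ i, θ i * (s i : ℝ)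

/-- `φ(m,θ) = Σ_{s ∈ U} e^{⟨θ,s⟩} m(s)`. -/
noncomputable def phi {d : ℕ} (U : Finset (Zd d)) (θ : Fin d → ℝ) (m : ↥U → ℝ) : ℝ :=
  ∑ s : ↥U, Real.exp (zdot θ (s : Zd d)) * m s

lemma zdot_sub_add {d : ℕ} (θ : Fin d → ℝ) (x s : Zd d) :
    zdot θ x = zdot θ (x - s) + zdot θ s := by
  simp only [zdot, ← Finset.sum_add_distrib]
  exact Finset.sum_congr rfl fun i _ => by push_cast [Pi.sub_apply]; ring

lemma phi_nonneg {d : ℕ} {U : Finset (Zd d)} {m : ↥U → ℝ} (hm : ∀ s, 0 ≤ m s)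
    (θ : Fin d → ℝ) : 0 ≤ phi U θ m :=
  Finset.sum_nonneg fun s _ => mul_nonneg (Real.exp_pos _).le (hm s)

/-- Convolution with a homogeneous kernel is a finite sum over the steps. -/
lemma kpow_mker_succ {d : ℕ} (U : Finset (Zd d)) (m : ↥U → ℝ) (n : ℕ) (y x : Zd d) :
    kpow (mker U fun _ => m) (n + 1) y x =
      ∑ s : ↥U, kpow (mker U fun _ => m) n y (x - s) * ENNReal.ofReal (m s) := by
  have hker : ∀ z : Zd d, mker U (fun _ => m) z x =
      ∑ s : ↥U, if z = x - s then ENNReal.ofReal (m s) else 0 := by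
    intro z
    unfold mker
    split_ifs with h
    · rw [Finset.sum_eq_single ⟨x - z, h⟩]
      · simp
      · intro s _ hs
        refine if_neg fun hz => hs (Subtype.ext ?_)
        simp [hz]
      · simp
    · refine (Finset.sum_eq_zero fun s _ => if_neg fun hz => h ?_).symm
      simp [hz]
  change ∑' z, kpow (mker U fun _ => m) n y z * mker U (fun _ => m) z x = _
  simp_rw [hker, Finset.mul_sum]
  rw [Summable.tsum_finsetSum fun _ _ => ENNReal.summable]
  refine Finset.sum_congr rfl fun s _ => ?_
  rw [tsum_eq_single (x - (s : Zd d)) fun z hz => by simp [hz]]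
  simp

lemma kpow_mker_mul_exp_le {d : ℕ} {U : Finset (Zd d)} {m : ↥U → ℝ} (hm : ∀ s, 0 ≤ m s)
    (θ : Fin d → ℝ) (n : ℕ) (x : Zd d) :
    kpow (mker U fun _ => m) n 0 x * ENNReal.ofReal (Real.exp (zdot θ x)) ≤
      ENNReal.ofReal (phi U θ m) ^ n := by
  induction n generalizing x with
  | zero =>
    by_cases h : (0 : Zd d) = x
    · subst h
      simp [kpow, zdot]
    · simp [kpow, h]
  | succ n ih =>
    have hphi : ENNReal.ofReal (phi U θ m) =
        ∑ s : ↥U, ENNReal.ofReal (Real.exp (zdot θ s)) * ENNReal.ofReal (m s) := by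
      rw [phi, ENNReal.ofReal_sum_of_nonneg fun s _ => mul_nonneg (Real.exp_pos _).le (hm s)]
      exact Finset.sum_congr rfl fun s _ => ENNReal.ofReal_mul (Real.exp_pos _).le
    rw [kpow_mker_succ, Finset.sum_mul, pow_succ]
    nth_rewrite 2 [hphi]
    rw [Finset.mul_sum]
    refine Finset.sum_le_sum fun s _ => ?_
    rw [zdot_sub_add θ x s, Real.exp_add, ENNReal.ofReal_mul (Real.exp_pos _).le]
    calc _ = (kpow (mker U fun _ => m) n 0 (x - s) *
          ENNReal.ofReal (Real.exp (zdot θ (x - s)))) *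
          (ENNReal.ofReal (Real.exp (zdot θ s)) * ENNReal.ofReal (m s)) := by ring
      _ ≤ _ := by gcongr; exact ih _

lemma rhoAt_mker_le {d : ℕ} {U : Finset (Zd d)} {m : ↥U → ℝ} (hm : ∀ s, 0 ≤ m s)
    (θ : Fin d → ℝ) : rhoAt (mker U fun _ => m) 0 0 ≤ ENNReal.ofReal (phi U θ m) := by
  refine limsup_le_of_le (by isBoundedDefault) ?_
  filter_upwards [eventually_ge_atTop 1] with n hn
  have h := kpow_mker_mul_exp_le hm θ n 0
  simp only [zdot, Pi.zero_apply, Int.cast_zero, mul_zero, Finset.sum_const_zero, Real.exp_zero,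
    ENNReal.ofReal_one, mul_one] at h
  calc _ ≤ (ENNReal.ofReal (phi U θ m) ^ n) ^ (1 / (n : ℝ)) := by gcongr
    _ = _ := by
      rw [one_div]
      exact ENNReal.pow_rpow_inv_natCast (by omega) _

/-- The generating element of a finitely supported homogeneous kernel in the monoid algebra. -/
noncomputable def stepElement {d : ℕ} (U : Finset (Zd d)) (m : ↥U → ℝ) :
    AddMonoidAlgebra ℝ≥0 (Zd d) :=
  ∑ s : ↥U, AddMonoidAlgebra.single (s : Zd d) (m s).toNNReal

lemma kpow_mker_eq_coeff {d : ℕ} (U : Finset (Zd d)) (m : ↥U → ℝ) (n : ℕ) (x : Zd d) :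
    kpow (mker U fun _ => m) n 0 x = ((stepElement U m ^ n).coeff x : ℝ≥0∞) := by
  induction n generalizing x with
  | zero =>
    by_cases h : (0 : Zd d) = x
    · subst h
      simp [kpow]
    · simp [kpow, AddMonoidAlgebra.one_def, h]
  | succ n ih =>
    rw [kpow_mker_succ, pow_succ]
    nth_rewrite 2 [stepElement]
    rw [Finset.mul_sum, AddMonoidAlgebra.coeff_sum, Finsupp.finsetSum_apply,
      ENNReal.ofNNReal_finsetSum]
    refine Finset.sum_congr rfl fun s _ => ?_
    rw [ih, AddMonoidAlgebra.coeff_mul_single_apply, ENNReal.coe_mul, sub_eq_add_neg]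
    rfl

/-- Closed walks with step counts `j` contribute a multinomial term to the return weight. -/
lemma multinomial_mul_prod_le_kpow {d : ℕ} {U : Finset (Zd d)} {m : ↥U → ℝ}
    (hm : ∀ s, 0 ≤ m s) (j : ↥U → ℕ) (hj : ∑ s : ↥U, j s • (s : Zd d) = 0) :
    ENNReal.ofReal (Nat.multinomial Finset.univ j * ∏ s, m s ^ j s) ≤
      kpow (mker U fun _ => m) (∑ s, j s) 0 0 := by
  rw [kpow_mker_eq_coeff, stepElement, Finset.sum_pow_eq_sum_piAntidiag,
    AddMonoidAlgebra.coeff_sum, Finsupp.finsetSum_apply]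
  have hmem : j ∈ Finset.piAntidiag Finset.univ (∑ s, j s) := by simp
  have h := Finset.single_le_sum (f := fun k : ↥U → ℕ =>
    (((Nat.multinomial Finset.univ k : AddMonoidAlgebra ℝ≥0 (Zd d)) *
      ∏ s : ↥U, AddMonoidAlgebra.single (s : Zd d) (m s).toNNReal ^ k s).coeff 0))
    (fun _ _ => zero_le) hmem
  refine le_trans (le_of_eq ?_) (ENNReal.coe_le_coe.2 h)
  simp only [AddMonoidAlgebra.single_pow]
  rw [AddMonoidAlgebra.prod_single, hj, ← nsmul_eq_mul _ (AddMonoidAlgebra.single _ _),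
    AddMonoidAlgebra.coeff_smul]
  simp only [ENNReal.ofReal, Finsupp.smul_apply, AddMonoidAlgebra.coeff_single,
    Finsupp.single_eq_same]
  congr 1
  ext
  rw [Real.coe_toNNReal _ (mul_nonneg (Nat.cast_nonneg _)
    (Finset.prod_nonneg fun s _ => pow_nonneg (hm s) _))]
  simp [hm]

lemma Real.log_factorial_le (n : ℕ) :
    Real.log n.factorial ≤ n * Real.log n - n + 1 + Real.log (n + 1) := by
  rcases Nat.eq_zero_or_pos n with rfl | hn
  · simp
  obtain ⟨k, rfl⟩ : ∃ k, n = k + 1 := ⟨n - 1, by omega⟩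
  have h := Stirling.log_stirlingSeq'_antitone (Nat.zero_le k)
  have h0 : Real.log (Stirling.stirlingSeq 1) = 1 - Real.log 2 / 2 := by
    rw [Stirling.stirlingSeq_one, Real.log_div (by positivity) (by positivity), Real.log_exp,
      Real.log_sqrt (by norm_num)]
  have hf := Stirling.log_stirlingSeq_formula (k + 1)
  simp only [Function.comp, Nat.succ_eq_add_one, zero_add, h0] at h
  have hpos : (0 : ℝ) < ((k + 1 : ℕ) : ℝ) := by positivity
  rw [hf, Real.log_div hpos.ne' (Real.exp_pos _).ne', Real.log_exp,
    Real.log_mul two_ne_zero hpos.ne'] at h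
  have h1 : Real.log ((k + 1 : ℕ) : ℝ) ≤ Real.log (((k + 1 : ℕ) : ℝ) + 1) :=
    Real.log_le_log hpos (by linarith)
  have h2 : 0 ≤ Real.log ((k + 1 : ℕ) : ℝ) := Real.log_natCast_nonneg _
  linarith

lemma Real.le_log_factorial (n : ℕ) : n * Real.log n - n ≤ Real.log n.factorial := by
  rcases Nat.eq_zero_or_pos n with rfl | hn
  · simp
  have h := Stirling.le_log_factorial_stirling hn.ne'
  have h2 : 0 ≤ Real.log (n : ℝ) := Real.log_natCast_nonneg _
  have h3 : 0 ≤ Real.log (2 * Real.pi) := Real.log_nonneg (by nlinarith [Real.pi_gt_three])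
  linarith

/-- Entropy lower bound for multinomial coefficients. -/
lemma le_log_multinomial {ι : Type*} [Fintype ι] (j : ι → ℕ) (hN : 0 < ∑ s, j s) :
    ((∑ s, j s : ℕ) : ℝ) * ∑ s, Real.negMulLog (j s / (∑ s, j s : ℕ)) -
        Fintype.card ι * (1 + Real.log ((∑ s, j s : ℕ) + 1)) ≤
      Real.log (Nat.multinomial Finset.univ j) := by
  set N := ∑ s, j s with hNdef
  have hN' : (0 : ℝ) < N := by exact_mod_cast hN
  have hspec := Nat.multinomial_spec Finset.univ j
  have hlog : ∑ s, Real.log (j s).factorial + Real.log (Nat.multinomial Finset.univ j) =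
      Real.log N.factorial := by
    rw [← hNdef] at hspec
    rw [← hspec, Nat.cast_mul, Nat.cast_prod, Real.log_mul, Real.log_prod]
    · exact fun s _ => by positivity
    · exact Finset.prod_ne_zero_iff.2 fun s _ => by positivity
    · exact_mod_cast (Nat.multinomial_pos _ _).ne'
  have hterm : ∀ s, (N : ℝ) * Real.negMulLog (j s / N) =
      (j s : ℝ) * Real.log N - j s * Real.log (j s) := by
    intro s
    rcases Nat.eq_zero_or_pos (j s) with h | h
    · simp [h]
    · have h' : (0 : ℝ) < j s := by exact_mod_cast h
      rw [Real.negMulLog, Real.log_div h'.ne' hN'.ne']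
      field_simp
      ring
  have hj : ∀ s, Real.log (j s).factorial ≤
      j s * Real.log (j s) - j s + (1 + Real.log ((N : ℝ) + 1)) := by
    intro s
    have h1 : Real.log ((j s : ℝ) + 1) ≤ Real.log ((N : ℝ) + 1) := by
      refine Real.log_le_log (by positivity) ?_
      have : j s ≤ N := Finset.single_le_sum (fun _ _ => Nat.zero_le _) (Finset.mem_univ s)
      have : (j s : ℝ) ≤ N := by exact_mod_cast this
      linarith
    linarith [Real.log_factorial_le (j s)]
  have hsum := Finset.sum_le_sum fun s (_ : s ∈ Finset.univ) => hj s
  have hcast : (N : ℝ) = ∑ s, (j s : ℝ) := by rw [hNdef]; push_cast; rfl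
  simp only [Finset.sum_add_distrib, Finset.sum_sub_distrib, ← hcast, Finset.sum_const,
    Finset.card_univ, nsmul_eq_mul] at hsum
  rw [Finset.mul_sum]
  simp only [hterm, Finset.sum_sub_distrib, ← Finset.sum_mul, ← hcast]
  linarith [Real.le_log_factorial N]

lemma continuous_zdot {d : ℕ} (s : Zd d) : Continuous fun θ : Fin d → ℝ => zdot θ s := by
  unfold zdot
  fun_prop

lemma continuous_phi {d : ℕ} (U : Finset (Zd d)) (m : ↥U → ℝ) :
    Continuous fun θ : Fin d → ℝ => phi U θ m := by
  unfold phi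
  exact continuous_finsetSum _ fun s _ =>
    (Real.continuous_exp.comp (continuous_zdot _)).mul continuous_const

lemma zdot_add_single {d : ℕ} (θ : Fin d → ℝ) (i : Fin d) (t : ℝ) (s : Zd d) :
    zdot (θ + Pi.single i t) s = zdot θ s + t * s i := by
  simp [zdot, add_mul, Finset.sum_add_distrib, Pi.single_apply]

lemma sum_sq_add_single {d : ℕ} (θ : Fin d → ℝ) (i : Fin d) (t : ℝ) :
    ∑ k, (θ + Pi.single i t : Fin d → ℝ) k ^ 2 = ∑ k, θ k ^ 2 + 2 * θ i * t + t ^ 2 := by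
  simp [add_sq, Finset.sum_add_distrib, Pi.single_apply]

/-- The Gaussian regularisation of `log φ` has a minimiser. -/
lemma exists_minimizer {d : ℕ} {U : Finset (Zd d)} {m : ↥U → ℝ} {c : ℝ} (hc : 0 < c)
    (hphi : ∀ θ, c ≤ phi U θ m) {ε : ℝ} (hε : 0 < ε) :
    ∃ θ : Fin d → ℝ, ∀ η : Fin d → ℝ,
      Real.log (phi U θ m) + ε * ∑ k, θ k ^ 2 ≤ Real.log (phi U η m) + ε * ∑ k, η k ^ 2 := by
  refine Continuous.exists_forall_le
    (f := fun θ : Fin d → ℝ => Real.log (phi U θ m) + ε * ∑ k, θ k ^ 2) ?_ ?_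
  · exact ((continuous_phi U m).log fun θ => (hc.trans_le (hphi θ)).ne').add (by fun_prop)
  · have hnorm : Tendsto (fun θ : Fin d → ℝ => Real.log c + ε * ‖θ‖ ^ 2)
        (cocompact _) atTop :=
      tendsto_atTop_add_const_left _ _ (Tendsto.const_mul_atTop hε
        ((tendsto_pow_atTop two_ne_zero).comp (tendsto_norm_cocompact_atTop)))
    refine tendsto_atTop_mono (fun θ => ?_) hnorm
    refine add_le_add (Real.log_le_log hc (hphi θ)) (mul_le_mul_of_nonneg_left ?_ hε.le)
    rw [← Real.le_sqrt (norm_nonneg _) (Finset.sum_nonneg fun _ _ => sq_nonneg _)]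
    refine (pi_norm_le_iff_of_nonneg (Real.sqrt_nonneg _)).2 fun i => ?_
    refine Real.le_sqrt_of_sq_le ?_
    rw [Real.norm_eq_abs, sq_abs]
    exact Finset.single_le_sum (f := fun k => θ k ^ 2) (fun _ _ => sq_nonneg _)
      (Finset.mem_univ i)

/-- First-order condition at a minimiser of the regularised `log φ`. -/
lemma sum_tilt_eq {d : ℕ} {U : Finset (Zd d)} {m : ↥U → ℝ} {c : ℝ} (hc : 0 < c)
    (hphi : ∀ θ, c ≤ phi U θ m) {ε : ℝ} {θ : Fin d → ℝ} (hθ : ∀ η : Fin d → ℝ,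
      Real.log (phi U θ m) + ε * ∑ k, θ k ^ 2 ≤ Real.log (phi U η m) + ε * ∑ k, η k ^ 2)
    (i : Fin d) :
    ∑ s : ↥U, Real.exp (zdot θ s) * m s / phi U θ m * ((s : Zd d) i : ℝ) = -(2 * ε * θ i) := by
  have hF : 0 < phi U θ m := hc.trans_le (hphi θ)
  have hmin : IsLocalMin (fun t : ℝ => Real.log (phi U (θ + Pi.single i t) m) +
      ε * ∑ k, (θ + Pi.single i t : Fin d → ℝ) k ^ 2) 0 := by
    refine Eventually.of_forall fun t => ?_
    simp only [Pi.single_zero, add_zero]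
    linarith [hθ (θ + Pi.single i t)]
  have hphi' : HasDerivAt (fun t : ℝ => phi U (θ + Pi.single i t) m)
      (∑ s : ↥U, Real.exp (zdot θ s) * ((s : Zd d) i : ℝ) * m s) 0 := by
    simp only [phi, zdot_add_single]
    refine HasDerivAt.fun_sum fun s _ => HasDerivAt.mul_const ?_ _
    have h := (((hasDerivAt_id (0 : ℝ)).mul_const ((s : Zd d) i : ℝ)).const_add (zdot θ s)).exp
    simpa using h
  have hsq : HasDerivAt (fun t : ℝ => ε * ∑ k, (θ + Pi.single i t : Fin d → ℝ) k ^ 2)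
      (ε * (2 * θ i)) 0 := by
    simp only [sum_sq_add_single]
    have h := ((((hasDerivAt_id (0 : ℝ)).const_mul (2 * θ i)).const_add (∑ k, θ k ^ 2)).add
      (hasDerivAt_pow 2 (0 : ℝ))).const_mul ε
    simpa using h
  have h0 := hmin.hasDerivAt_eq_zero ((hphi'.log (by simpa using hF.ne')).add hsq)
  simp only [Pi.single_zero, add_zero] at h0
  rw [Finset.sum_div] at h0
  have : ∑ s : ↥U, Real.exp (zdot θ s) * m s / phi U θ m * ((s : Zd d) i : ℝ) =
      ∑ s : ↥U, Real.exp (zdot θ s) * ((s : Zd d) i : ℝ) * m s / phi U θ m :=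
    Finset.sum_congr rfl fun s _ => by ring
  linarith

/-- The relative entropy functional `p ↦ Σ_s p_s log (m_s / p_s)`. -/
noncomputable def relEntropy {ι : Type*} [Fintype ι] (m p : ι → ℝ) : ℝ :=
  ∑ s, (Real.negMulLog (p s) + p s * Real.log (m s))

lemma continuous_relEntropy {ι : Type*} [Fintype ι] (m : ι → ℝ) : Continuous (relEntropy m) :=
  continuous_finsetSum _ fun s _ =>
    (Real.continuous_negMulLog.comp (continuous_apply s)).add
      ((continuous_apply s).mul continuous_const)

lemma exists_almost_centered {d : ℕ} {U : Finset (Zd d)} {m : ↥U → ℝ} (hm : ∀ s, 0 ≤ m s)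
    {c : ℝ} (hc : 0 < c) (hphi : ∀ θ, c ≤ phi U θ m) {ε : ℝ} (hε : 0 < ε) :
    ∃ p ∈ stdSimplex ℝ ↥U, (∀ s, m s = 0 → p s = 0) ∧
      (∀ i, (∑ s : ↥U, p s * ((s : Zd d) i : ℝ)) ^ 2 ≤
        4 * ε * (Real.log (phi U 0 m) - Real.log c)) ∧
      Real.log c ≤ relEntropy m p := by
  obtain ⟨θ, hθ⟩ := exists_minimizer hc hphi hε
  have hF : 0 < phi U θ m := hc.trans_le (hphi θ)
  have hlog : Real.log c ≤ Real.log (phi U θ m) := Real.log_le_log hc (hphi θ)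
  have hgrad := sum_tilt_eq hc hphi hθ
  set p : ↥U → ℝ := fun s => Real.exp (zdot θ s) * m s / phi U θ m with hp
  have hsum : ∑ s, p s = 1 := by
    rw [hp, ← Finset.sum_div]
    exact div_self hF.ne'
  refine ⟨p, ⟨fun s => ?_, hsum⟩, fun s hs => by simp [hp, hs], fun i => ?_, ?_⟩
  · exact div_nonneg (mul_nonneg (Real.exp_pos _).le (hm s)) hF.le
  · rw [hgrad i]
    have h0 := hθ 0
    have h1 : θ i ^ 2 ≤ ∑ k, θ k ^ 2 :=
      Finset.single_le_sum (f := fun k => θ k ^ 2) (fun _ _ => sq_nonneg _) (Finset.mem_univ i)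
    simp only [Pi.zero_apply, ne_eq, OfNat.ofNat_ne_zero, not_false_eq_true, zero_pow,
      Finset.sum_const_zero, mul_zero, add_zero] at h0
    nlinarith [mul_le_mul_of_nonneg_left h1 hε.le]
  · have hterm : ∀ s, Real.negMulLog (p s) + p s * Real.log (m s) =
        p s * Real.log (phi U θ m) - p s * zdot θ s := by
      intro s
      by_cases hs : m s = 0
      · simp [hp, hs]
      · have hlp : Real.log (p s) = zdot θ s + Real.log (m s) - Real.log (phi U θ m) := by
          rw [hp]
          simp only
          rw [Real.log_div (mul_ne_zero (Real.exp_pos _).ne' hs) hF.ne',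
            Real.log_mul (Real.exp_pos _).ne' hs, Real.log_exp]
        rw [Real.negMulLog, hlp]
        ring
    have hdot : ∑ s : ↥U, p s * zdot θ s = -(2 * ε * ∑ i, θ i ^ 2) := by
      calc ∑ s : ↥U, p s * zdot θ s = ∑ i, θ i * ∑ s : ↥U, p s * ((s : Zd d) i : ℝ) := by
            simp only [zdot, Finset.mul_sum]
            rw [Finset.sum_comm]
            exact Finset.sum_congr rfl fun i _ => Finset.sum_congr rfl fun s _ => by ring
        _ = ∑ i, θ i * -(2 * ε * θ i) := Finset.sum_congr rfl fun i _ => by rw [hgrad i]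
        _ = _ := by
            rw [Finset.mul_sum, ← Finset.sum_neg_distrib]
            exact Finset.sum_congr rfl fun i _ => by ring
    rw [relEntropy]
    simp only [hterm, Finset.sum_sub_distrib, ← Finset.sum_mul, hsum, hdot]
    have : 0 ≤ ε * ∑ i, θ i ^ 2 :=
      mul_nonneg hε.le (Finset.sum_nonneg fun _ _ => sq_nonneg _)
    linarith

/-- Entropy duality: a lower bound for `φ` yields a centered step distribution of large relative
entropy. -/
lemma exists_centered {d : ℕ} {U : Finset (Zd d)} {m : ↥U → ℝ} (hm : ∀ s, 0 ≤ m s)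
    {c : ℝ} (hc : 0 < c) (hphi : ∀ θ, c ≤ phi U θ m) :
    ∃ p ∈ stdSimplex ℝ ↥U, (∀ s, m s = 0 → p s = 0) ∧
      (∀ i, ∑ s : ↥U, p s * ((s : Zd d) i : ℝ) = 0) ∧ Real.log c ≤ relEntropy m p := by
  choose p hpmem hp0 hpsq hpent using fun n : ℕ =>
    exists_almost_centered hm hc hphi (ε := 1 / ((n : ℝ) + 1)) (by positivity)
  obtain ⟨q, hq, φ, hφ, hlim⟩ := (isCompact_stdSimplex ℝ ↥U).tendsto_subseq hpmem
  have hcoord : ∀ s, Tendsto (fun n => p (φ n) s) atTop (nhds (q s)) :=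
    fun s => (tendsto_pi_nhds.1 hlim) s
  refine ⟨q, hq, fun s hs => ?_, fun i => ?_, ?_⟩
  · refine tendsto_nhds_unique (hcoord s) ?_
    simp [hp0 _ s hs]
  · have h1 : Tendsto (fun n => (∑ s : ↥U, p (φ n) s * ((s : Zd d) i : ℝ)) ^ 2) atTop
        (nhds ((∑ s : ↥U, q s * ((s : Zd d) i : ℝ)) ^ 2)) :=
      (tendsto_finsetSum _ fun s _ => (hcoord s).mul_const _).pow 2
    have h2 : Tendsto (fun n => 4 * (1 / ((φ n : ℝ) + 1)) *
        (Real.log (phi U 0 m) - Real.log c)) atTop (nhds 0) := by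
      have := ((tendsto_one_div_add_atTop_nhds_zero_nat (𝕜 := ℝ)).comp
        hφ.tendsto_atTop).const_mul 4 |>.mul_const (Real.log (phi U 0 m) - Real.log c)
      simpa using this
    have h3 := le_of_tendsto_of_tendsto' h1 h2 fun n => hpsq (φ n) i
    exact pow_eq_zero_iff two_ne_zero |>.1 (le_antisymm h3 (sq_nonneg _))
  · exact ge_of_tendsto' (((continuous_relEntropy m).tendsto q).comp hlim) fun n => hpent (φ n)

/-- A centered real step distribution is approximated by step counts of closed walks. -/
lemma exists_closed_counts {d : ℕ} {U : Finset (Zd d)} {p : ↥U → ℝ}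
    (hp : p ∈ stdSimplex ℝ ↥U) (hcent : ∀ i, ∑ s : ↥U, p s * ((s : Zd d) i : ℝ) = 0) :
    ∃ j : ℕ → ↥U → ℕ, (∀ n, ∑ s : ↥U, j n s • (s : Zd d) = 0) ∧
      (∀ n s, p s = 0 → j n s = 0) ∧ Tendsto (fun n => ∑ s, j n s) atTop atTop ∧
      ∀ s, Tendsto (fun n => (j n s : ℝ) / (∑ s, j n s : ℕ)) atTop (nhds (p s)) := by
  set k : ℕ → ↥U → ℕ := fun n s => ⌊p s * n⌋₊ with hk
  set X : ℕ → Zd d := fun n => ∑ s : ↥U, k n s • (s : Zd d) with hX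
  have hbound : ∀ n i, |X n i| ≤ ∑ s : ↥U, |(s : Zd d) i| := by
    intro n i
    have hXi : ((X n i : ℤ) : ℝ) = ∑ s : ↥U, ((k n s : ℝ) - p s * n) * ((s : Zd d) i : ℝ) := by
      have : ∑ s : ↥U, p s * n * ((s : Zd d) i : ℝ) = 0 := by
        rw [← mul_zero (n : ℝ), ← hcent i, Finset.mul_sum]
        exact Finset.sum_congr rfl fun s _ => by ring
      simp only [sub_mul, Finset.sum_sub_distrib, this, sub_zero]
      simp [hX]
    have : |((X n i : ℤ) : ℝ)| ≤ ∑ s : ↥U, |((s : Zd d) i : ℝ)| := by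
      rw [hXi]
      refine (Finset.abs_sum_le_sum_abs _ _).trans (Finset.sum_le_sum fun s _ => ?_)
      rw [abs_mul]
      refine mul_le_of_le_one_left (abs_nonneg _) ?_
      have h0 : 0 ≤ p s * n := mul_nonneg (hp.1 s) n.cast_nonneg
      have h1 := Nat.floor_le h0
      have h2 := Nat.lt_floor_add_one (p s * n)
      rw [abs_le]
      constructor <;> simp only [hk] <;> linarith
    exact_mod_cast this
  have hfin : (Set.Icc (fun i => -∑ s : ↥U, |(s : Zd d) i|)
      (fun i => ∑ s : ↥U, |(s : Zd d) i|) : Set (Zd d)).Finite := Set.finite_Icc _ _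
  have hmem : ∀ n, X n ∈ (Set.Icc (fun i => -∑ s : ↥U, |(s : Zd d) i|)
      (fun i => ∑ s : ↥U, |(s : Zd d) i|) : Set (Zd d)) := fun n =>
    ⟨fun i => (abs_le.1 (hbound n i)).1, fun i => (abs_le.1 (hbound n i)).2⟩
  obtain ⟨x, hx⟩ : ∃ x, ∃ᶠ n in atTop, X n = x := by
    by_contra! hcon
    obtain ⟨n, hn⟩ := ((eventually_all_finite hfin).2 fun x _ => hcon x).exists
    exact hn (X n) (hmem n) rfl
  obtain ⟨φ, hφ, hφx⟩ := extraction_of_frequently_atTop hx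
  have hmono : ∀ n s, k (φ 0) s ≤ k (φ n) s := fun n s =>
    Nat.floor_le_floor (mul_le_mul_of_nonneg_left
      (Nat.cast_le.2 (hφ.monotone n.zero_le)) (hp.1 s))
  have hφtop : Tendsto (fun n => (φ n : ℝ)) atTop atTop :=
    tendsto_natCast_atTop_atTop.comp hφ.tendsto_atTop
  have hlim : ∀ s, Tendsto (fun n => ((k (φ n) s - k (φ 0) s : ℕ) : ℝ) / φ n) atTop
      (nhds (p s)) := by
    intro s
    have h1 := (tendsto_nat_floor_mul_div_atTop (hp.1 s)).comp hφtop
    have h2 : Tendsto (fun n => (k (φ 0) s : ℝ) / φ n) atTop (nhds 0) :=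
      tendsto_const_nhds.div_atTop hφtop
    have h3 := h1.sub h2
    rw [sub_zero] at h3
    refine h3.congr fun n => ?_
    rw [Nat.cast_sub (hmono n s), sub_div]
    rfl
  have hlimN : Tendsto (fun n => ((∑ s, (k (φ n) s - k (φ 0) s) : ℕ) : ℝ) / φ n) atTop
      (nhds 1) := by
    rw [← hp.2]
    refine (tendsto_finsetSum Finset.univ fun s _ => hlim s).congr fun n => ?_
    rw [Nat.cast_sum, Finset.sum_div]
  have hφpos : ∀ᶠ n in atTop, (φ n : ℝ) ≠ 0 := hφtop.eventually_ne_atTop 0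
  refine ⟨fun n s => k (φ n) s - k (φ 0) s, fun n => ?_, fun n s hs => ?_, ?_, fun s => ?_⟩
  · have h := (hφx n).trans (hφx 0).symm
    simp only [hX] at h
    rw [← sub_eq_zero, ← Finset.sum_sub_distrib] at h
    rw [← h]
    exact Finset.sum_congr rfl fun s _ => by rw [sub_nsmul _ (hmono n s), sub_eq_add_neg]
  · simp [hk, hs]
  · rw [← tendsto_natCast_atTop_iff (R := ℝ)]
    refine (hlimN.pos_mul_atTop one_pos hφtop).congr' ?_
    filter_upwards [hφpos] with n hn
    exact div_mul_cancel₀ _ hn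
  · have h := (hlim s).div hlimN one_ne_zero
    rw [div_one] at h
    refine h.congr' ?_
    filter_upwards [hφpos] with n hn
    exact div_div_div_cancel_right₀ hn _ _

lemma exp_relEntropy_le_kpow {d : ℕ} {U : Finset (Zd d)} {m : ↥U → ℝ} (hm : ∀ s, 0 ≤ m s)
    (j : ↥U → ℕ) (hj : ∑ s : ↥U, j s • (s : Zd d) = 0) (hj0 : ∀ s, m s = 0 → j s = 0)
    (hN : 0 < ∑ s, j s) :
    ENNReal.ofReal (Real.exp (relEntropy m (fun s => (j s : ℝ) / (∑ s, j s : ℕ)) -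
      Fintype.card ↥U * ((1 + Real.log ((∑ s, j s : ℕ) + 1)) / (∑ s, j s : ℕ)))) ≤
      kpow (mker U fun _ => m) (∑ s, j s) 0 0 ^ (1 / ((∑ s, j s : ℕ) : ℝ)) := by
  have hmul := le_log_multinomial j hN
  have hwalk := multinomial_mul_prod_le_kpow hm j hj
  set N := ∑ s, j s with hNdef
  have hN' : (0 : ℝ) < N := by exact_mod_cast hN
  have hprod : ∀ s, m s ^ j s ≠ 0 := fun s hs => by
    obtain ⟨h, h'⟩ := pow_eq_zero_iff' |>.1 hs
    exact h' (hj0 s h)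
  have hpos : 0 < (Nat.multinomial Finset.univ j : ℝ) * ∏ s, m s ^ j s :=
    mul_pos (by exact_mod_cast Nat.multinomial_pos _ _)
      (Finset.prod_pos fun s _ => (pow_nonneg (hm s) _).lt_of_ne (hprod s).symm)
  have hlog : (N : ℝ) * (relEntropy m (fun s => (j s : ℝ) / N) -
      Fintype.card ↥U * ((1 + Real.log ((N : ℝ) + 1)) / N)) ≤
      Real.log (Nat.multinomial Finset.univ j * ∏ s, m s ^ j s) := by
    rw [Real.log_mul (by exact_mod_cast (Nat.multinomial_pos _ _).ne')
      (Finset.prod_ne_zero_iff.2 fun s _ => hprod s), Real.log_prod fun s _ => hprod s]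
    have h1 : (N : ℝ) * ∑ s, (j s : ℝ) / N * Real.log (m s) = ∑ s, Real.log (m s ^ j s) := by
      rw [Finset.mul_sum]
      refine Finset.sum_congr rfl fun s _ => ?_
      rw [Real.log_pow]
      field_simp
    have h2 : (N : ℝ) * (Fintype.card ↥U * ((1 + Real.log ((N : ℝ) + 1)) / N)) =
        Fintype.card ↥U * (1 + Real.log ((N : ℝ) + 1)) := by
      field_simp
    rw [relEntropy, Finset.sum_add_distrib, mul_sub, mul_add, h1, h2]
    linarith
  have hexp := (Real.le_log_iff_exp_le hpos).1 hlog
  rw [one_div, ENNReal.le_rpow_inv_iff hN', ENNReal.rpow_natCast,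
    ← ENNReal.ofReal_pow (Real.exp_pos _).le, ← Real.exp_nat_mul]
  exact (ENNReal.ofReal_le_ofReal hexp).trans hwalk

lemma le_rhoAt_mker {d : ℕ} {U : Finset (Zd d)} {m : ↥U → ℝ} (hm : ∀ s, 0 ≤ m s)
    {c : ℝ} (hc : 0 < c) (hphi : ∀ θ, c ≤ phi U θ m) :
    ENNReal.ofReal c ≤ rhoAt (mker U fun _ => m) 0 0 := by
  obtain ⟨p, hp, hp0, hcent, hent⟩ := exists_centered hm hc hphi
  obtain ⟨j, hj, hjp, hjN, hjlim⟩ := exists_closed_counts hp hcent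
  have hentlim : Tendsto (fun n => relEntropy m (fun s => (j n s : ℝ) / (∑ s, j n s : ℕ)))
      atTop (nhds (relEntropy m p)) :=
    ((continuous_relEntropy m).tendsto p).comp (tendsto_pi_nhds.2 hjlim)
  have herr : Tendsto (fun N : ℕ => (1 + Real.log ((N : ℝ) + 1)) / N) atTop (nhds 0) := by
    have h1 : Tendsto (fun N : ℕ => 1 / (N : ℝ)) atTop (nhds 0) :=
      tendsto_one_div_atTop_nhds_zero_nat
    have h2 : Tendsto (fun x : ℝ => Real.log (x + 1) / x) atTop (nhds 0) := by
      have h3 : (fun x : ℝ => Real.log (x + 1)) =o[atTop] fun x : ℝ => x + 1 :=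
        Real.isLittleO_log_id_atTop.comp_tendsto (tendsto_atTop_add_const_right _ 1 tendsto_id)
      have h4 : (fun x : ℝ => x + 1) =O[atTop] fun x : ℝ => x :=
        (Asymptotics.isBigO_refl _ _).add
          (Asymptotics.isLittleO_const_id_atTop (1 : ℝ)).isBigO
      exact (h3.trans_isBigO h4).tendsto_div_nhds_zero
    have h := h1.add (h2.comp tendsto_natCast_atTop_atTop)
    rw [add_zero] at h
    exact h.congr fun N => by simp [add_div]
  have hlim : Tendsto (fun n => ENNReal.ofReal (Real.exp
      (relEntropy m (fun s => (j n s : ℝ) / (∑ s, j n s : ℕ)) -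
      Fintype.card ↥U * ((1 + Real.log ((∑ s, j n s : ℕ) + 1)) / (∑ s, j n s : ℕ)))))
      atTop (nhds (ENNReal.ofReal (Real.exp (relEntropy m p)))) := by
    refine ENNReal.tendsto_ofReal ((Real.continuous_exp.tendsto _).comp ?_)
    have h := hentlim.sub ((herr.comp hjN).const_mul (Fintype.card ↥U : ℝ))
    rw [mul_zero, sub_zero] at h
    exact h
  have hcle : ENNReal.ofReal c ≤ ENNReal.ofReal (Real.exp (relEntropy m p)) :=
    ENNReal.ofReal_le_ofReal ((Real.log_le_iff_le_exp hc).1 hent)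
  refine le_of_forall_lt_imp_le_of_dense fun r hr => ?_
  refine le_limsup_of_frequently_le ?_ (by isBoundedDefault)
  refine hjN.frequently (Eventually.frequently ?_)
  filter_upwards [hlim.eventually (lt_mem_nhds (hr.trans_le hcle)),
    hjN.eventually_gt_atTop 0] with n hn hN
  exact hn.le.trans (exp_relEntropy_le_kpow hm (j n) (hj n)
    (fun s hs => hjp n s (hp0 s hs)) hN)

/-- For a homogeneous kernel `M^h_m` with `m` positive on a generating set `S ⊆ U`,
`ρ(M^h_m) = inf_θ Σ_{s ∈ U} e^{⟨θ,s⟩} m(s)`. -/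
theorem rho_homogeneous {d : ℕ} (hd : 1 ≤ d) (U : Finset (Zd d))
    (m : ↥U → ℝ) (hm : ∀ s, 0 ≤ m s)
    (S : Finset (Zd d)) (hSU : S ⊆ U)
    (hSgen : AddSubgroup.closure (S : Set (Zd d)) = ⊤)
    (hpos : ∀ s (hs : s ∈ S), 0 < m ⟨s, hSU hs⟩) :
    rhoAt (mker U (fun _ => m)) 0 0 = ⨅ θ : Fin d → ℝ, ENNReal.ofReal (phi U θ m) := by
  refine le_antisymm (le_iInf fun θ => rhoAt_mker_le hm θ) ?_
  have htop : ⨅ θ : Fin d → ℝ, ENNReal.ofReal (phi U θ m) ≠ ⊤ :=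
    ((iInf_le (fun θ : Fin d → ℝ => ENNReal.ofReal (phi U θ m)) 0).trans_lt
      ENNReal.ofReal_lt_top).ne
  rw [← ENNReal.ofReal_toReal htop]
  rcases ENNReal.toReal_nonneg.eq_or_lt with h | h
  · rw [← h]
    simp
  · exact le_rhoAt_mker hm h fun θ =>
      ENNReal.toReal_le_of_le_ofReal (phi_nonneg hm θ) (iInf_le _ θ)
end

section
/- Let d ≥ 1 and let U ⊂ ℤ^d be a finite set that generates ℤ^d as a group. Let K be a compact subset of the functions U → [0,∞) such that for some ε > 0 and some subset S ⊆ U generating ℤ^d as a group, every m ∈ K satisfies m(s) ≥ ε for all s ∈ S, and let K̂ denote the convex hull of K. Then sup{ ρ(M_σ) : σ an environment with σ_x ∈ K for all x ∈ ℤ^d } = sup{ ρ(M_σ̂) : σ̂ an environment with σ̂_x ∈ K̂ for all x ∈ ℤ^d }. -/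
open Filter
open scoped ENNReal NNReal

section Kernel

variable {X : Type*} [DecidableEq X] (k : X → X → ℝ≥0∞)

lemma tsum_kpow_zero_mul (v : X → ℝ≥0∞) (x : X) : ∑' z, kpow k 0 x z * v z = v x := by
  rw [tsum_eq_single x (fun z hz => by simp [kpow, hz.symm])]
  simp [kpow]

lemma kpow_add (m n : ℕ) (x y : X) :
    kpow k (m + n) x y = ∑' z, kpow k m x z * kpow k n z y := by
  induction n generalizing y with
  | zero =>
    rw [tsum_eq_single y (fun z hz => by simp [kpow, hz])]
    simp [kpow]
  | succ n ih =>
    calc kpow k (m + (n + 1)) x y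
        = ∑' w, (∑' z, kpow k m x z * kpow k n z w) * k w y := by
          simp only [← ih]; rfl
      _ = ∑' w, ∑' z, kpow k m x z * (kpow k n z w * k w y) := by
          simp only [← ENNReal.tsum_mul_right, mul_assoc]
      _ = ∑' z, ∑' w, kpow k m x z * (kpow k n z w * k w y) := ENNReal.tsum_comm
      _ = ∑' z, kpow k m x z * kpow k (n + 1) z y := by
          simp only [ENNReal.tsum_mul_left]; rfl

lemma kpow_one (x y : X) : kpow k 1 x y = k x y :=
  tsum_kpow_zero_mul k (fun z => k z y) x

lemma kpow_succ_left (n : ℕ) (x y : X) :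
    kpow k (n + 1) x y = ∑' z, k x z * kpow k n z y := by
  simp only [add_comm n 1, kpow_add k 1 n, kpow_one]

variable {k}

lemma pow_mul_le_tsum_kpow_mul {v : X → ℝ≥0∞} {μ : ℝ≥0∞}
    (h : ∀ x, μ * v x ≤ ∑' z, k x z * v z) (n : ℕ) (x : X) :
    μ ^ n * v x ≤ ∑' z, kpow k n x z * v z := by
  induction n with
  | zero => simp [tsum_kpow_zero_mul]
  | succ n ih =>
    calc μ ^ (n + 1) * v x = μ * (μ ^ n * v x) := by ring
      _ ≤ μ * ∑' w, kpow k n x w * v w := by gcongr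
      _ = ∑' w, kpow k n x w * (μ * v w) := by
          rw [← ENNReal.tsum_mul_left]; exact tsum_congr fun w => by ring
      _ ≤ ∑' w, kpow k n x w * ∑' z, k w z * v z :=
          ENNReal.tsum_le_tsum fun w => mul_le_mul_right (h w) _
      _ = ∑' w, ∑' z, kpow k n x w * (k w z * v z) := by simp only [ENNReal.tsum_mul_left]
      _ = ∑' z, ∑' w, kpow k n x w * (k w z * v z) := ENNReal.tsum_comm
      _ = ∑' z, kpow k (n + 1) x z * v z := by
          simp only [← mul_assoc, ENNReal.tsum_mul_right]; rfl

/-- A finitely supported subeigenvector bounds the spectral radius from below at a state with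
which every state of its support communicates. -/
lemma le_rhoAt_of_forall_exists_kpow_ne_zero {w : X → ℝ≥0∞} {μ : ℝ≥0∞} {C : Finset X} {y : X}
    (hμ0 : μ ≠ 0) (hμ : μ ≠ ⊤) (hwC : ∀ z, z ∉ C → w z = 0) (hw : ∀ z, w z ≠ ⊤)
    (hwy : w y ≠ 0) (hC : ∀ z ∈ C, ∃ l, kpow k l z y ≠ 0)
    (h : ∀ x, μ * w x ≤ ∑' z, k x z * w z) : μ ≤ rhoAt k y y := by
  by_contra! hlt
  obtain ⟨ν, hν1, hν2⟩ := exists_between hlt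
  have hν : ν ≠ ⊤ := hν2.ne_top
  have hev : ∀ᶠ n : ℕ in atTop, kpow k n y y ≤ ν ^ n := by
    filter_upwards [eventually_lt_of_limsup_lt hν1, eventually_ge_atTop 1] with n hn hn1
    have hn0 : (0 : ℝ) < n := by exact_mod_cast hn1
    rw [one_div] at hn
    have := (ENNReal.rpow_inv_le_iff hn0).1 hn.le
    simpa using this
  choose! l hl using hC
  have hbound : ∀ z ∈ C, ∀ᶠ n : ℕ in atTop,
      kpow k n y z ≤ ν ^ n * (ν ^ l z / kpow k (l z) z y) := by
    intro z hz
    have hz' := (tendsto_add_atTop_nat (l z)).eventually hev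
    filter_upwards [hz'] with n hn
    rw [← mul_div_assoc, ENNReal.le_div_iff_mul_le (Or.inl (hl z hz))
      (Or.inr (ENNReal.mul_ne_top (ENNReal.pow_ne_top hν) (ENNReal.pow_ne_top hν))), ← pow_add]
    exact (kpow_mul_kpow_le k n (l z) y z y).trans hn
  set D : ℝ≥0∞ := ∑ z ∈ C, ν ^ l z / kpow k (l z) z y * w z with hD
  have hDtop : D ≠ ⊤ := by
    refine (ENNReal.sum_lt_top.2 fun z hz => ?_).ne
    exact (ENNReal.mul_ne_top (ENNReal.div_ne_top (ENNReal.pow_ne_top hν) (hl z hz)) (hw z)).lt_top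
  have hmain : ∀ᶠ n : ℕ in atTop, w y ≤ D * (ν / μ) ^ n := by
    filter_upwards [(Finset.eventually_all C).2 hbound] with n hn
    have h1 : μ ^ n * w y ≤ D * ν ^ n :=
      calc μ ^ n * w y ≤ ∑' z, kpow k n y z * w z := pow_mul_le_tsum_kpow_mul h n y
        _ = ∑ z ∈ C, kpow k n y z * w z :=
            tsum_eq_sum fun z hz => by rw [hwC z hz, mul_zero]
        _ ≤ ∑ z ∈ C, ν ^ n * (ν ^ l z / kpow k (l z) z y) * w z :=
            Finset.sum_le_sum fun z hz => mul_le_mul_left (hn z hz) _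
        _ = D * ν ^ n := by
            rw [hD, Finset.sum_mul]; exact Finset.sum_congr rfl fun z _ => by ring
    have hpow : (ν / μ) ^ n = ν ^ n / μ ^ n := by
      rw [div_eq_mul_inv, mul_pow, ← ENNReal.inv_pow, div_eq_mul_inv]
    rw [hpow, ← mul_div_assoc, ENNReal.le_div_iff_mul_le (Or.inl (pow_ne_zero n hμ0))
      (Or.inl (ENNReal.pow_ne_top hμ)), mul_comm]
    exact h1
  have hr : ν / μ < 1 := ENNReal.div_lt_of_lt_mul (by rwa [one_mul])
  have hlim : Tendsto (fun n : ℕ => D * (ν / μ) ^ n) atTop (nhds (D * 0)) :=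
    ENNReal.Tendsto.const_mul (ENNReal.tendsto_pow_atTop_nhds_zero_of_lt_one hr) (Or.inr hDtop)
  have := ge_of_tendsto hlim hmain
  rw [mul_zero] at this
  exact hwy (le_antisymm this zero_le)

/-- A nonzero finitely supported `v` with `μ v ≤ k v` bounds the spectral radius of `k` from
below by `μ` at some state. -/
lemma exists_le_rhoAt_self {v : X → ℝ≥0∞} {μ : ℝ≥0∞} (hμ0 : μ ≠ 0) (hμ : μ ≠ ⊤)
    (hfin : (Function.support v).Finite) (hne : (Function.support v).Nonempty)
    (hv : ∀ z, v z ≠ ⊤) (h : ∀ x, μ * v x ≤ ∑' z, k x z * v z) : ∃ y, μ ≤ rhoAt k y y := by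
  classical
  set W : Finset X := hfin.toFinset with hW
  let C : X → Finset X := fun x => {z ∈ W | ∃ l, kpow k l x z ≠ 0}
  have hself : ∀ x ∈ W, x ∈ C x := fun x hx =>
    Finset.mem_filter.2 ⟨hx, 0, by simp [kpow]⟩
  have htrans : ∀ x, ∀ z ∈ C x, C z ⊆ C x := by
    intro x z hz t ht
    obtain ⟨-, l, hl⟩ := Finset.mem_filter.1 hz
    obtain ⟨htW, l', hl'⟩ := Finset.mem_filter.1 ht
    refine Finset.mem_filter.2 ⟨htW, l + l', fun h0 => ?_⟩
    exact mul_ne_zero hl hl' (le_antisymm (h0 ▸ kpow_mul_kpow_le k l l' x z t) zero_le)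
  obtain ⟨y, hyW, hymin⟩ := Finset.exists_min_image W (fun x => (C x).card)
    ((Set.Finite.toFinset_nonempty hfin).2 hne)
  have hCeq : ∀ z ∈ C y, C z = C y := fun z hz =>
    Finset.eq_of_subset_of_card_le (htrans y z hz) (hymin z (Finset.mem_filter.1 hz).1)
  refine ⟨y, le_rhoAt_of_forall_exists_kpow_ne_zero (C := C y)
    (w := fun z => if z ∈ C y then v z else 0) hμ0 hμ (fun z hz => if_neg hz) (fun z => ?_) ?_
    (fun z hz => ?_) fun x => ?_⟩
  · split_ifs
    exacts [hv z, ENNReal.zero_ne_top]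
  · rw [if_pos (hself y hyW)]
    simpa [hW] using hyW
  · have : y ∈ C z := hCeq z hz ▸ hself y hyW
    exact (Finset.mem_filter.1 this).2
  · by_cases hx : x ∈ C y
    · rw [if_pos hx]
      refine (h x).trans (ENNReal.tsum_le_tsum fun z => ?_)
      by_cases hz : z ∈ C y
      · rw [if_pos hz]
      · rw [if_neg hz, mul_zero, nonpos_iff_eq_zero, mul_eq_zero]
        by_contra! hcon
        have hzx : z ∈ C x := Finset.mem_filter.2
          ⟨by simpa [hW] using hcon.2, 1, by simpa [kpow_one] using hcon.1⟩
        exact hz (htrans y x hx hzx)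
    · simp [hx]

lemma mul_sum_inv_pow_mul_kpow_le {μ : ℝ≥0∞} (hμ0 : μ ≠ 0) (hμ : μ ≠ ⊤) {n : ℕ} {o : X}
    (hn : μ ^ n ≤ kpow k n o o) (x : X) :
    μ * ∑ j ∈ Finset.range n, μ⁻¹ ^ j * kpow k j x o ≤
      ∑' z, k x z * ∑ j ∈ Finset.range n, μ⁻¹ ^ j * kpow k j z o := by
  have hshift : ∑' z, k x z * ∑ j ∈ Finset.range n, μ⁻¹ ^ j * kpow k j z o =
      μ * ∑ j ∈ Finset.range n, μ⁻¹ ^ (j + 1) * kpow k (j + 1) x o := by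
    simp only [Finset.mul_sum]
    rw [Summable.tsum_finsetSum fun _ _ => ENNReal.summable]
    refine Finset.sum_congr rfl fun j _ => ?_
    rw [kpow_succ_left, ← ENNReal.tsum_mul_left, ← ENNReal.tsum_mul_left]
    refine tsum_congr fun z => ?_
    calc k x z * (μ⁻¹ ^ j * kpow k j z o)
        = (μ * μ⁻¹) * (k x z * (μ⁻¹ ^ j * kpow k j z o)) := by
          rw [ENNReal.mul_inv_cancel hμ0 hμ, one_mul]
      _ = μ * (μ⁻¹ ^ (j + 1) * (k x z * kpow k j z o)) := by ring
  rw [hshift]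
  refine mul_le_mul_right ?_ _
  have hlast : kpow k 0 x o ≤ μ⁻¹ ^ n * kpow k n x o := by
    by_cases hx : x = o
    · subst hx
      calc kpow k 0 x x = μ⁻¹ ^ n * μ ^ n := by
            rw [← mul_pow, ENNReal.inv_mul_cancel hμ0 hμ, one_pow]; simp [kpow]
        _ ≤ μ⁻¹ ^ n * kpow k n x x := mul_le_mul_right hn _
    · simp [kpow, hx]
  have h0 : kpow k 0 x o ≠ ⊤ := by
    simp only [kpow]; split_ifs <;> simp
  have hsum := (Finset.sum_range_succ (fun j => μ⁻¹ ^ j * kpow k j x o) n).symm.trans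
    (Finset.sum_range_succ' (fun j => μ⁻¹ ^ j * kpow k j x o) n)
  rw [pow_zero, one_mul] at hsum
  refine (ENNReal.add_le_add_iff_right h0).1 ?_
  rw [← hsum]
  exact add_le_add_right hlast _

end Kernel

section Environment

variable {d : ℕ} (U : Finset (Zd d)) (σ : Zd d → ↥U → ℝ)

lemma tsum_mker_mul (v : Zd d → ℝ≥0∞) (x : Zd d) :
    ∑' z, mker U σ x z * v z = ∑ s : ↥U, ENNReal.ofReal (σ x s) * v (x + s) := by
  rw [← (Equiv.addLeft x).tsum_eq, tsum_eq_sum (s := U), ← Finset.sum_coe_sort]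
  · refine Finset.sum_congr rfl fun s _ => ?_
    simp [mker]
  · intro s hs
    simp [mker, hs]

lemma kpow_mker_ne_top (n : ℕ) (x y : Zd d) : kpow (mker U σ) n x y ≠ ⊤ := by
  induction n generalizing x with
  | zero => simp only [kpow]; split_ifs <;> simp
  | succ n ih =>
    rw [kpow_succ_left, tsum_mker_mul]
    exact (ENNReal.sum_lt_top.2 fun s _ =>
      (ENNReal.mul_ne_top ENNReal.ofReal_ne_top (ih _)).lt_top).ne

lemma finite_setOf_kpow_mker_ne_zero (n : ℕ) (y : Zd d) :
    {x | kpow (mker U σ) n x y ≠ 0}.Finite := by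
  induction n with
  | zero =>
    refine (Set.finite_singleton y).subset fun x hx => ?_
    by_contra hxy
    exact hx (if_neg hxy)
  | succ n ih =>
    refine (ih.image2 (fun z s => z - s) U.finite_toSet).subset fun x hx => ?_
    rw [Set.mem_ofPred_eq, kpow_succ_left, tsum_mker_mul] at hx
    obtain ⟨s, -, hs⟩ := Finset.exists_ne_zero_of_sum_ne_zero hx
    exact ⟨x + s, right_ne_zero_of_mul hs, s, s.2, by simp⟩

lemma kpow_mker_translate (y : Zd d) (n : ℕ) (x z : Zd d) :
    kpow (mker U fun t => σ (t + y)) n x z = kpow (mker U σ) n (x + y) (z + y) := by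
  induction n generalizing z with
  | zero => simp [kpow]
  | succ n ih =>
    refine (tsum_congr fun w => ?_).trans ((Equiv.addRight y).tsum_eq fun w =>
      kpow (mker U σ) n (x + y) w * mker U σ w (z + y))
    simp [ih, mker]

lemma rhoAt_mker_translate (y : Zd d) :
    rhoAt (mker U fun t => σ (t + y)) 0 0 = rhoAt (mker U σ) y y := by
  simp [rhoAt, kpow_mker_translate]

variable {U}

lemma nonneg_of_mem_convexHull {ι : Type*} {K : Set (ι → ℝ)} (hK : ∀ m ∈ K, ∀ s, 0 ≤ m s)
    {m : ι → ℝ} (hm : m ∈ convexHull ℝ K) (s : ι) : 0 ≤ m s :=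
  convexHull_min (t := Set.Ici (0 : ι → ℝ)) (fun m hm => hK m hm) (convex_Ici _) hm s

lemma exists_mem_sum_mul_le_of_mem_convexHull {ι : Type*} [Fintype ι] {K : Set (ι → ℝ)}
    {m : ι → ℝ} (hm : m ∈ convexHull ℝ K) (a : ι → ℝ) :
    ∃ m' ∈ K, ∑ s, m s * a s ≤ ∑ s, m' s * a s := by
  have hconv : ConvexOn ℝ (convexHull ℝ K) (Fintype.linearCombination ℝ a) :=
    LinearMap.convexOn _ (convex_convexHull ℝ K)
  obtain ⟨m', hm', h⟩ := hconv.exists_ge_of_mem_convexHull (subset_convexHull ℝ K) hm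
  exact ⟨m', hm', by simpa [Fintype.linearCombination_apply] using h⟩

/-- A row in the convex hull can be replaced by a row in the set itself without decreasing the
pairing with a given finite nonnegative function. -/
lemma exists_mem_sum_ofReal_mul_le {K : Set (↥U → ℝ)} (hK : ∀ m ∈ K, ∀ s, 0 ≤ m s)
    {m : ↥U → ℝ} (hm : m ∈ convexHull ℝ K) {v : ↥U → ℝ≥0∞} (hv : ∀ s, v s ≠ ⊤) :
    ∃ m' ∈ K, ∑ s, ENNReal.ofReal (m s) * v s ≤ ∑ s, ENNReal.ofReal (m' s) * v s := by
  have key : ∀ m : ↥U → ℝ, (∀ s, 0 ≤ m s) →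
      ∑ s, ENNReal.ofReal (m s) * v s = ENNReal.ofReal (∑ s, m s * (v s).toReal) := by
    intro m hm
    rw [ENNReal.ofReal_sum_of_nonneg fun s _ => mul_nonneg (hm s) ENNReal.toReal_nonneg]
    refine Finset.sum_congr rfl fun s _ => ?_
    rw [ENNReal.ofReal_mul (hm s), ENNReal.ofReal_toReal (hv s)]
  obtain ⟨m', hm', h⟩ := exists_mem_sum_mul_le_of_mem_convexHull hm fun s => (v s).toReal
  refine ⟨m', hm', ?_⟩
  rw [key m (nonneg_of_mem_convexHull hK hm), key m' (hK m' hm')]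
  exact ENNReal.ofReal_le_ofReal h

variable {σ}

lemma exists_env_le_rhoAt_mker {K : Set (↥U → ℝ)} (hK : ∀ m ∈ K, ∀ s, 0 ≤ m s)
    (hσ : ∀ z, σ z ∈ convexHull ℝ K) {μ : ℝ≥0∞} (hμ0 : μ ≠ 0)
    (hμ : μ < rhoAt (mker U σ) 0 0) :
    ∃ τ : Zd d → ↥U → ℝ, (∀ z, τ z ∈ K) ∧ μ ≤ rhoAt (mker U τ) 0 0 := by
  have hμt : μ ≠ ⊤ := hμ.ne_top
  obtain ⟨n, hn, hn1⟩ := ((frequently_lt_of_lt_limsup (by isBoundedDefault) hμ).and_eventually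
    (eventually_ge_atTop 1)).exists
  have hpow : μ ^ n ≤ kpow (mker U σ) n 0 0 := by
    have hn0 : (0 : ℝ) < n := by exact_mod_cast hn1
    rw [one_div] at hn
    simpa using (ENNReal.le_rpow_inv_iff hn0).1 hn.le
  set v : Zd d → ℝ≥0∞ :=
    fun x => ∑ j ∈ Finset.range n, μ⁻¹ ^ j * kpow (mker U σ) j x 0 with hv
  have hvt : ∀ x, v x ≠ ⊤ := fun x => (ENNReal.sum_lt_top.2 fun j _ =>
    (ENNReal.mul_ne_top (ENNReal.pow_ne_top (ENNReal.inv_ne_top.2 hμ0))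
      (kpow_mker_ne_top U σ j x 0)).lt_top).ne
  have hfin : (Function.support v).Finite := by
    refine ((Finset.range n).finite_toSet.biUnion fun j _ =>
      finite_setOf_kpow_mker_ne_zero U σ j 0).subset fun x hx => ?_
    obtain ⟨j, hj, hj0⟩ := Finset.exists_ne_zero_of_sum_ne_zero hx
    exact Set.mem_biUnion hj (right_ne_zero_of_mul hj0)
  have hne : (Function.support v).Nonempty := by
    refine ⟨0, fun h0 => ?_⟩
    have := (Finset.sum_eq_zero_iff.1 h0) 0 (Finset.mem_range.2 hn1)
    simp [kpow] at this
  choose τ hτK hτ using fun x => exists_mem_sum_ofReal_mul_le hK (hσ x) fun s => hvt (x + s)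
  have hsub : ∀ x, μ * v x ≤ ∑' z, mker U τ x z * v z := fun x => by
    refine (mul_sum_inv_pow_mul_kpow_le hμ0 hμt hpow x).trans ?_
    rw [tsum_mker_mul U τ]
    exact (tsum_mker_mul U σ v x).trans_le (hτ x)
  obtain ⟨y, hy⟩ := exists_le_rhoAt_self hμ0 hμt hfin hne hvt hsub
  exact ⟨fun t => τ (t + y), fun z => hτK _, hy.trans_eq (rhoAt_mker_translate U τ y).symm⟩

end Environment

/-- The supremum of the spectral radii over environments with values in `K` equals the
supremum over environments with values in the convex hull `K̂` of `K`. -/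
theorem sup_rho_convexHull {d : ℕ} (hd : 1 ≤ d) (U : Finset (Zd d))
    (hUgen : AddSubgroup.closure (U : Set (Zd d)) = ⊤)
    (K : Set (↥U → ℝ)) (hKcomp : IsCompact K) (hKpos : ∀ m ∈ K, ∀ s, 0 ≤ m s)
    (ε : ℝ) (hε : 0 < ε) (S : Finset (Zd d)) (hSU : S ⊆ U)
    (hSgen : AddSubgroup.closure (S : Set (Zd d)) = ⊤)
    (hKS : ∀ m ∈ K, ∀ s (hs : s ∈ S), ε ≤ m ⟨s, hSU hs⟩) :
    (⨆ (σ : Zd d → ↥U → ℝ) (_ : ∀ z : Zd d, σ z ∈ K), rhoAt (mker U σ) 0 0) =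
      ⨆ (σ : Zd d → ↥U → ℝ) (_ : ∀ z : Zd d, σ z ∈ convexHull ℝ K),
        rhoAt (mker U σ) 0 0 := by
  refine le_antisymm
    (iSup_mono fun σ => iSup_mono' fun hσ => ⟨fun z => subset_convexHull ℝ K (hσ z), le_rfl⟩)
    (iSup₂_le fun σ hσ => le_of_forall_lt_imp_le_of_dense fun μ hμ => ?_)
  rcases eq_or_ne μ 0 with rfl | hμ0
  · exact zero_le
  obtain ⟨τ, hτ, hle⟩ := exists_env_le_rhoAt_mker hKpos hσ hμ0 hμ
  exact hle.trans (le_iSup₂_of_le τ hτ le_rfl)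
end

section
/- Let d ≥ 1 and let U ⊂ ℤ^d be a finite set that generates ℤ^d as a group. Let K be a compact subset of the functions U → [0,∞) such that for some ε > 0 and some subset S ⊆ U generating ℤ^d as a group, every m ∈ K satisfies m(s) ≥ ε for all s ∈ S, and let K̂ denote the convex hull of K. Then sup{ ρ(M_σ̂) : σ̂ an environment with σ̂_x ∈ K̂ for all x ∈ ℤ^d } = sup_{m∈K̂} ρ(M^h_m) = sup_{m∈K̂} inf_{θ∈ℝ^d} Σ_{s∈U} e^{⟨θ,s⟩} m(s), where M^h_m is the homogeneous kernel given by the constant environment σ_x = m for all x. -/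
open Filter
open scoped ENNReal NNReal

/-- An approximate minimax theorem for concave-convex real functions on a compact set. -/
lemma exists_forall_lt_of_forall_exists_le {E F : Type*}
    [TopologicalSpace E] [AddCommGroup E] [Module ℝ E] [IsTopologicalAddGroup E]
    [ContinuousSMul ℝ E]
    [TopologicalSpace F] [AddCommGroup F] [Module ℝ F] [IsTopologicalAddGroup F]
    [ContinuousSMul ℝ F] {X : Set E} {f : E → F → ℝ}
    (hne : X.Nonempty) (hX : Convex ℝ X) (hcomp : IsCompact X)
    (hcontX : ∀ y, Continuous fun x => f x y) (hcontY : ∀ x, Continuous (f x))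
    (hconcX : ∀ y, ConcaveOn ℝ X fun x => f x y)
    (hconvY : ∀ x ∈ X, ConvexOn ℝ Set.univ (f x))
    {t t' : ℝ} (h : ∀ y, ∃ x ∈ X, t ≤ f x y) (ht : t' < t) :
    ∃ x ∈ X, ∀ y, t' < f x y := by
  have hmono : Monotone Real.toEReal := EReal.coe_strictMono.monotone
  have key := Sion.minimax' (X := X) (Y := (Set.univ : Set F))
    (f := fun x y => ((-f x y : ℝ) : EReal)) hne hX hcomp
    (fun y _ => (continuous_coe_real_ereal.comp
      (hcontX y).neg).lowerSemicontinuous.lowerSemicontinuousOn X)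
    (fun y _ => ((hconcX y).neg.quasiconvexOn).monotone_comp (g := Real.toEReal) hmono)
    convex_univ
    (fun x _ => (continuous_coe_real_ereal.comp
      (hcontY x).neg).upperSemicontinuous.upperSemicontinuousOn _)
    (fun x hx => ((hconvY x hx).neg.quasiconcaveOn).monotone_comp (g := Real.toEReal) hmono)
  have hlt : (⨅ x ∈ X, ⨆ y ∈ (Set.univ : Set F), ((-f x y : ℝ) : EReal)) < ((-t' : ℝ) : EReal) := by
    rw [key]
    refine lt_of_le_of_lt (b := ((-t : ℝ) : EReal)) ?_ (by exact_mod_cast neg_lt_neg ht)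
    refine iSup₂_le fun y _ => ?_
    obtain ⟨x, hx, hxy⟩ := h y
    exact iInf₂_le_of_le x hx (by exact_mod_cast neg_le_neg hxy)
  simp only [iInf_lt_iff] at hlt
  obtain ⟨x, hx, hlt⟩ := hlt
  refine ⟨x, hx, fun y => ?_⟩
  have := lt_of_le_of_lt (le_iSup₂ (f := fun y (_ : y ∈ (Set.univ : Set F)) =>
    ((-f x y : ℝ) : EReal)) y (Set.mem_univ y)) hlt
  have h2 : -f x y < -t' := by exact_mod_cast this
  linarith

/-- The convex hull of a compact subset of a finite-dimensional space is compact. -/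
lemma isCompact_convexHull_of_isCompact {E : Type*} [TopologicalSpace E] [AddCommGroup E]
    [Module ℝ E] [IsTopologicalAddGroup E] [ContinuousSMul ℝ E] [FiniteDimensional ℝ E]
    {K : Set E} (hK : IsCompact K) : IsCompact (convexHull ℝ K) := by
  rcases K.eq_empty_or_nonempty with rfl | ⟨x₀, hx₀⟩
  · simp
  let n := Module.finrank ℝ E + 1
  let Φ : (Fin n → ℝ) × (Fin n → E) → E := fun q => ∑ i, q.1 i • q.2 i
  have hΦ : Continuous Φ := by fun_prop
  have himage : convexHull ℝ K = Φ '' (stdSimplex ℝ (Fin n) ×ˢ Set.univ.pi fun _ => K) := by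
    apply Set.Subset.antisymm
    · intro x hx
      obtain ⟨ι, _, z, w, hz, hind, hw, hw1, rfl⟩ := eq_pos_convex_span_of_mem_convexHull hx
      have hcard : Fintype.card ι ≤ Fintype.card (Fin n) := by
        simpa [n] using hind.card_le_finrank_succ.trans
          (Nat.succ_le_succ (Submodule.finrank_le _))
      obtain ⟨e⟩ := Function.Embedding.nonempty_of_card_le hcard
      refine ⟨(Function.extend e w 0, Function.extend e z fun _ => x₀), ⟨⟨?_, ?_⟩, ?_⟩, ?_⟩
      · intro j
        by_cases hj : ∃ i, e i = j
        · obtain ⟨i, rfl⟩ := hj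
          simpa [e.injective.extend_apply] using (hw i).le
        · simp [Function.extend_apply' _ _ _ hj]
      · rw [← hw1]
        symm
        refine Fintype.sum_of_injective e e.injective _ _ (fun j hj => ?_) (fun i => ?_)
        · exact Function.extend_apply' _ _ _ hj
        · simp [e.injective.extend_apply]
      · intro j _
        by_cases hj : ∃ i, e i = j
        · obtain ⟨i, rfl⟩ := hj
          simpa [e.injective.extend_apply] using hz ⟨i, rfl⟩
        · simpa [Function.extend_apply' _ _ _ hj] using hx₀
      · symm
        refine Fintype.sum_of_injective e e.injective _ _ (fun j hj => ?_) (fun i => ?_)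
        · simp only [Function.extend_apply' w _ _ hj, Pi.zero_apply, zero_smul]
        · simp [e.injective.extend_apply]
    · rintro _ ⟨⟨w, z⟩, ⟨⟨hw, hw1⟩, hz⟩, rfl⟩
      exact (convex_convexHull ℝ K).sum_mem (fun i _ => hw i) hw1
        fun i _ => subset_convexHull ℝ K (hz i (Set.mem_univ i))
  rw [himage]
  exact ((isCompact_stdSimplex ℝ (Fin n)).prod (isCompact_univ_pi fun _ => hK)).image hΦ

/-- A nonnegative real relation between integer vectors on which a linear functional is positive
can be replaced by one with natural number coefficients. -/
lemma exists_nat_relation_of_real_relation {ι κ : Type*} [Fintype ι]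
    (v : ι → κ → ℤ) (w p : ι → ℝ) (hp : ∀ i, 0 ≤ p i)
    (hv : ∀ j, ∑ i, p i * (v i j : ℝ) = 0) (hw : 0 < ∑ i, p i * w i) :
    ∃ N : ι → ℕ, ∑ i, N i • v i = 0 ∧ 0 < ∑ i, (N i : ℝ) * w i := by
  classical
  let V := Submodule.span ℚ (Set.range p)
  have : FiniteDimensional ℚ V := FiniteDimensional.span_of_finite ℚ (Set.finite_range p)
  let b := Module.finBasis ℚ V
  let P : ι → V := fun i => ⟨p i, Submodule.subset_span ⟨i, rfl⟩⟩
  let q : ι → _ → ℚ := fun i k => b.repr (P i) k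
  have hpq : ∀ i, p i = ∑ k, (q i k : ℝ) * (b k : ℝ) := by
    intro i
    have h1 := congrArg (Subtype.val) (b.sum_repr (P i))
    simp only [Submodule.coe_sum, Submodule.coe_smul] at h1
    rw [show p i = (P i : ℝ) from rfl, ← h1]
    exact Finset.sum_congr rfl fun k _ => by rw [Rat.smul_def]
  have hrel : ∀ j k, ∑ i, q i k * (v i j : ℚ) = 0 := by
    intro j k
    have h0 : ∑ i, (v i j : ℚ) • P i = 0 := by
      ext
      simp only [Submodule.coe_sum, Submodule.coe_smul, Submodule.coe_zero]
      rw [← hv j]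
      refine Finset.sum_congr rfl fun i _ => ?_
      rw [Rat.smul_def, mul_comm]
      simp [P]
    have h1 := congrArg (fun x => b.repr x k) h0
    simp only [map_sum, map_smul, Finsupp.coe_finsetSum, Finset.sum_apply, Finsupp.smul_apply,
      smul_eq_mul, map_zero, Finsupp.coe_zero, Pi.zero_apply] at h1
    rw [← h1]
    exact Finset.sum_congr rfl fun i _ => mul_comm _ _
  let F : (Fin (Module.finrank ℚ V) → ℝ) → ι → ℝ := fun β i => ∑ k, (q i k : ℝ) * β k
  have hF : ∀ i, Continuous fun β => F β i := fun i => by fun_prop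
  let O : Set (Fin (Module.finrank ℚ V) → ℝ) :=
    (⋂ i ∈ {i | 0 < p i}, {β | 0 < F β i}) ∩ {β | 0 < ∑ i, F β i * w i}
  have hO : IsOpen O := by
    refine IsOpen.inter ?_ (isOpen_lt continuous_const (by fun_prop))
    exact (Set.toFinite _).isOpen_biInter fun i _ => isOpen_lt continuous_const (hF i)
  have hbO : (fun k => (b k : ℝ)) ∈ O := by
    have : F (fun k => (b k : ℝ)) = p := funext fun i => (hpq i).symm
    refine ⟨?_, ?_⟩
    · simp only [Set.mem_iInter, Set.mem_ofPred_eq, this]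
      exact fun i hi => hi
    · simpa [this] using hw
  have hdense : DenseRange (Pi.map fun (_ : Fin (Module.finrank ℚ V)) (x : ℚ) => (x : ℝ)) :=
    DenseRange.piMap fun _ => Rat.denseRange_cast
  obtain ⟨β, hβ⟩ := hdense.exists_mem_open hO ⟨_, hbO⟩
  let G : ι → ℚ := fun i => ∑ k, q i k * β k
  have hFG : ∀ i, F (Pi.map (fun _ (x : ℚ) => (x : ℝ)) β) i = (G i : ℝ) := fun i => by
    simp [F, G, Pi.map]
  have hG0 : ∀ i, 0 ≤ G i := by
    intro i
    rcases (hp i).eq_or_lt with h | h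
    · have : P i = 0 := Subtype.ext h.symm
      simp [G, q, this]
    · have h2 := hβ.1
      simp only [Set.mem_iInter, Set.mem_ofPred_eq] at h2
      have h3 := h2 i h
      rw [hFG] at h3
      exact_mod_cast h3.le
  have hGw : 0 < ∑ i, (G i : ℝ) * w i := by
    have h2 := hβ.2
    simpa only [Set.mem_ofPred_eq, hFG] using h2
  have hGv : ∀ j, ∑ i, G i * (v i j : ℚ) = 0 := by
    intro j
    simp only [G, Finset.sum_mul]
    rw [Finset.sum_comm]
    refine Finset.sum_eq_zero fun k _ => ?_
    calc ∑ i, q i k * β k * (v i j : ℚ) = β k * ∑ i, q i k * (v i j : ℚ) := by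
          rw [Finset.mul_sum]; exact Finset.sum_congr rfl fun i _ => by ring
      _ = 0 := by rw [hrel, mul_zero]
  let D : ℕ := ∏ i, (G i).den
  have hD : 0 < D := Finset.prod_pos fun i _ => (G i).den_pos
  have hN : ∀ i, ∃ n : ℕ, (n : ℚ) = D * G i := by
    intro i
    obtain ⟨c, hc⟩ : (G i).den ∣ D := Finset.dvd_prod_of_mem _ (Finset.mem_univ i)
    refine ⟨c * (G i).num.toNat, ?_⟩
    have h1 : (((G i).num.toNat : ℕ) : ℚ) = (G i).num := by
      exact_mod_cast Int.toNat_of_nonneg (Rat.num_nonneg.2 (hG0 i))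
    have h2 := Rat.mul_den_eq_num (G i)
    rw [hc]
    push_cast
    rw [h1, ← h2]
    ring
  choose N hN using hN
  have hNr : ∀ i, (N i : ℝ) = D * G i := fun i => by exact_mod_cast hN i
  refine ⟨N, ?_, ?_⟩
  · funext j
    have : (∑ i, (N i : ℚ) * (v i j : ℚ)) = 0 := by
      simp only [hN, mul_assoc, ← Finset.mul_sum, hGv, mul_zero]
    simp only [Finset.sum_apply, nsmul_eq_mul, Pi.zero_apply]
    exact_mod_cast this
  · simp only [hNr, mul_assoc, ← Finset.mul_sum]
    positivity

lemma zdot_add {d : ℕ} (θ : Fin d → ℝ) (x y : Zd d) : zdot θ (x + y) = zdot θ x + zdot θ y := by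
  simp [zdot, mul_add, Finset.sum_add_distrib]

lemma zdot_smul_add_smul {d : ℕ} (a b : ℝ) (θ₁ θ₂ : Fin d → ℝ) (s : Zd d) :
    zdot (a • θ₁ + b • θ₂) s = a * zdot θ₁ s + b * zdot θ₂ s := by
  simp only [zdot, Finset.mul_sum, ← Finset.sum_add_distrib]
  exact Finset.sum_congr rfl fun i _ => by simp; ring

/-- If every linear functional `θ` satisfies `L ≤ ⟨θ, v i⟩ + c i` for some `i`, then the vectors
`v i` satisfy a relation with natural number coefficients along which `c` averages to more than
any given `L' < L`. -/
lemma exists_nat_relation_of_forall_exists_le {d : ℕ} {ι : Type*} [Fintype ι]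
    (v : ι → Zd d) (c : ι → ℝ) {L L' : ℝ} (h : ∀ θ, ∃ i, L ≤ zdot θ (v i) + c i) (hL : L' < L) :
    ∃ N : ι → ℕ, ∑ i, N i • v i = 0 ∧ 0 < ∑ i, (N i : ℝ) * (c i - L') := by
  classical
  have hne : Nonempty ι := ⟨(h 0).choose⟩
  obtain ⟨p, hp, hpL⟩ := exists_forall_lt_of_forall_exists_le (X := stdSimplex ℝ ι)
    (f := fun p (θ : Fin d → ℝ) => ∑ i, p i * (zdot θ (v i) + c i))
    ⟨_, single_mem_stdSimplex ℝ hne.some⟩ (convex_stdSimplex ℝ ι) (isCompact_stdSimplex ℝ ι)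
    (fun θ => by fun_prop) (fun p => by unfold zdot; fun_prop)
    (fun θ => ⟨convex_stdSimplex ℝ ι, fun x _ y _ a b _ _ _ => le_of_eq <| by
      simp only [smul_eq_mul, Finset.mul_sum, ← Finset.sum_add_distrib]
      exact Finset.sum_congr rfl fun i _ => by simp; ring⟩)
    (fun p _ => ⟨convex_univ, fun x _ y _ a b _ _ hab => le_of_eq <| by
      simp only [smul_eq_mul, Finset.mul_sum, ← Finset.sum_add_distrib, zdot_smul_add_smul]
      exact Finset.sum_congr rfl fun i _ => by
        linear_combination (-(p i * c i)) * hab⟩)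
    (t := L) (t' := L') (fun θ => by
      obtain ⟨i, hi⟩ := h θ
      exact ⟨_, single_mem_stdSimplex ℝ i, by simpa [Pi.single_apply] using hi⟩) hL
  have hexpand : ∀ θ : Fin d → ℝ, ∑ i, p i * (zdot θ (v i) + c i) =
      (∑ j, θ j * ∑ i, p i * (v i j : ℝ)) + ∑ i, p i * c i := by
    intro θ
    simp only [mul_add, Finset.sum_add_distrib, zdot, Finset.mul_sum]
    rw [Finset.sum_comm]
    congr 1
    exact Finset.sum_congr rfl fun i _ => Finset.sum_congr rfl fun j _ => by ring
  simp only [hexpand] at hpL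
  refine exists_nat_relation_of_real_relation v _ p hp.1 (fun j => ?_) ?_
  · by_contra hj
    have := hpL (Pi.single j (-(∑ i, p i * c i - L') / ∑ i, p i * (v i j : ℝ)))
    simp only [Pi.single_apply, ite_mul, zero_mul, Finset.sum_ite_eq', Finset.mem_univ, if_true,
      div_mul_cancel₀ _ hj] at this
    linarith
  · have := hpL 0
    simp only [mul_sub, Finset.sum_sub_distrib, ← Finset.sum_mul, hp.2]
    simp at this
    linarith

lemma tsum_mker_mul_exp {d : ℕ} (U : Finset (Zd d)) (σ : Zd d → ↥U → ℝ) (θ : Fin d → ℝ)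
    (z : Zd d) (hσ : ∀ s, 0 ≤ σ z s) :
    ∑' y, mker U σ z y * ENNReal.ofReal (Real.exp (zdot θ y)) =
      ENNReal.ofReal (Real.exp (zdot θ z)) * ENNReal.ofReal (phi U θ (σ z)) := by
  rw [← (Equiv.addLeft z).tsum_eq, tsum_eq_sum (s := U), ← Finset.sum_coe_sort, phi,
    ENNReal.ofReal_sum_of_nonneg (fun s _ => mul_nonneg (Real.exp_nonneg _) (hσ s)),
    Finset.mul_sum]
  · refine Finset.sum_congr rfl fun s _ => ?_
    simp only [mker, Equiv.coe_addLeft, add_sub_cancel_left, s.2, dif_pos, zdot_add, Real.exp_add]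
    rw [ENNReal.ofReal_mul (Real.exp_nonneg _), ENNReal.ofReal_mul (Real.exp_nonneg _)]
    ring
  · intro s hs
    simp [mker, hs]

lemma tsum_kpow_succ_mul {X : Type*} [DecidableEq X] (k : X → X → ℝ≥0∞) (g : X → ℝ≥0∞) (n : ℕ)
    (x : X) : ∑' y, kpow k (n + 1) x y * g y = ∑' z, kpow k n x z * ∑' y, k z y * g y := by
  simp only [kpow, ← ENNReal.tsum_mul_right, ← ENNReal.tsum_mul_left]
  rw [ENNReal.tsum_comm]
  simp only [mul_assoc]

/-- A kernel which multiplies the positive function `g` by at most `C` has spectral radius at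
most `C`. -/
lemma rhoAt_le_of_superharmonic {X : Type*} [DecidableEq X] (k : X → X → ℝ≥0∞) (g : X → ℝ≥0∞)
    (C : ℝ≥0∞) (hg : ∀ z, ∑' y, k z y * g y ≤ C * g z) (x : X) (hx : g x ≠ 0) (hx' : g x ≠ ∞) :
    rhoAt k x x ≤ C := by
  have hsum : ∀ n, ∑' y, kpow k n x y * g y ≤ C ^ n * g x := by
    intro n
    induction n with
    | zero => rw [tsum_eq_single x] <;> simp +contextual [kpow, eq_comm]
    | succ n ih =>
      rw [tsum_kpow_succ_mul]
      calc ∑' z, kpow k n x z * ∑' y, k z y * g y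
          ≤ ∑' z, kpow k n x z * (C * g z) :=
            ENNReal.tsum_le_tsum fun z => by gcongr; exact hg z
        _ = C * ∑' z, kpow k n x z * g z := by
            rw [← ENNReal.tsum_mul_left]; exact tsum_congr fun z => by ring
        _ ≤ C * (C ^ n * g x) := by gcongr
        _ = C ^ (n + 1) * g x := by ring
  have hle : ∀ n, kpow k n x x ≤ C ^ n := fun n =>
    (ENNReal.mul_le_mul_iff_left hx hx').1 ((ENNReal.le_tsum x).trans (hsum n))
  refine Filter.limsup_le_of_le (h := ?_)
  filter_upwards [Filter.eventually_ge_atTop 1] with n hn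
  have hn0 : (n : ℝ) ≠ 0 := by positivity
  calc kpow k n x x ^ (1 / (n : ℝ)) ≤ (C ^ n) ^ (1 / (n : ℝ)) :=
        ENNReal.rpow_le_rpow (hle n) (by positivity)
    _ = C := by rw [← ENNReal.rpow_natCast, ← ENNReal.rpow_mul, mul_one_div_cancel hn0,
        ENNReal.rpow_one]

/-- A geometric lower bound on return probabilities at the multiples of a fixed time bounds the
spectral radius from below. -/
lemma le_rhoAt_of_pow_le {X : Type*} [DecidableEq X] (k : X → X → ℝ≥0∞) (x : X) (r : ℝ≥0∞)
    {q : ℕ} (hq : 0 < q) (h : ∀ j, r ^ (q * j) ≤ kpow k (q * j) x x) : r ≤ rhoAt k x x := by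
  refine Filter.le_limsup_of_frequently_le' ?_
  rw [Filter.frequently_atTop]
  intro a
  refine ⟨q * (a + 1), by nlinarith, ?_⟩
  have hn0 : ((q * (a + 1) : ℕ) : ℝ) ≠ 0 := by positivity
  calc r = (r ^ (q * (a + 1))) ^ (1 / ((q * (a + 1) : ℕ) : ℝ)) := by
        rw [← ENNReal.rpow_natCast, ← ENNReal.rpow_mul, mul_one_div_cancel hn0, ENNReal.rpow_one]
    _ ≤ _ := ENNReal.rpow_le_rpow (h _) (by positivity)

section Homogeneous

variable {d : ℕ} (U : Finset (Zd d)) (m : ↥U → ℝ)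

lemma tsum_kpow_homogeneous_mul_exp (hm : ∀ s, 0 ≤ m s) (θ : Fin d → ℝ) (n : ℕ) :
    ∑' x, kpow (mker U fun _ => m) n 0 x * ENNReal.ofReal (Real.exp (zdot θ x)) =
      ENNReal.ofReal (phi U θ m) ^ n := by
  induction n with
  | zero => rw [tsum_eq_single 0] <;> simp +contextual [kpow, zdot, eq_comm]
  | succ n ih =>
    rw [tsum_kpow_succ_mul, pow_succ, ← ih, ← ENNReal.tsum_mul_right]
    refine tsum_congr fun z => ?_
    rw [tsum_mker_mul_exp U _ θ z hm, mul_assoc]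

lemma kpow_homogeneous_mul_le (a b : ℕ) (x y : Zd d) :
    kpow (mker U fun _ => m) a 0 x * kpow (mker U fun _ => m) b 0 y ≤
      kpow (mker U fun _ => m) (a + b) 0 (x + y) := by
  induction b generalizing y with
  | zero =>
    by_cases h : (0 : Zd d) = y
    · subst h; simp [kpow]
    · simp [kpow, h]
  | succ b ih =>
    rw [← add_assoc]
    simp only [kpow]
    rw [← ENNReal.tsum_mul_left, ← (Equiv.addLeft x).tsum_eq (fun z =>
      kpow (mker U fun _ => m) (a + b) 0 z * mker U (fun _ => m) z (x + y))]
    refine ENNReal.tsum_le_tsum fun z => ?_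
    have hk : mker U (fun _ => m) (x + z) (x + y) = mker U (fun _ => m) z y := by
      simp [mker]
    rw [← mul_assoc, Equiv.coe_addLeft, hk]
    gcongr
    exact ih z

lemma pow_kpow_homogeneous_le (n : ℕ) (x : Zd d) (N : ℕ) :
    kpow (mker U fun _ => m) n 0 x ^ N ≤ kpow (mker U fun _ => m) (n * N) 0 (N • x) := by
  induction N with
  | zero => simp [kpow]
  | succ N ih =>
    rw [pow_succ, mul_add, mul_one, add_smul, one_smul]
    exact (mul_le_mul_left ih _).trans (kpow_homogeneous_mul_le U m _ _ _ _)

lemma prod_pow_kpow_homogeneous_le {ι : Type*} (n : ℕ) (v : ι → Zd d) (N : ι → ℕ)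
    (s : Finset ι) :
    ∏ i ∈ s, kpow (mker U fun _ => m) n 0 (v i) ^ N i ≤
      kpow (mker U fun _ => m) (n * ∑ i ∈ s, N i) 0 (∑ i ∈ s, N i • v i) := by
  classical
  induction s using Finset.induction_on with
  | empty => simp [kpow]
  | insert i s his ih =>
    rw [Finset.prod_insert his, Finset.sum_insert his, Finset.sum_insert his, mul_add]
    exact (mul_le_mul' (pow_kpow_homogeneous_le U m n _ _) ih).trans
      (kpow_homogeneous_mul_le U m _ _ _ _)

/-- The range of the kernel bounds the displacement. -/
lemma exists_kpow_homogeneous_eq_zero :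
    ∃ R : ℕ, ∀ n (x : Zd d), x ∉ Finset.Icc (fun _ => -((R * n : ℕ) : ℤ))
      (fun _ => ((R * n : ℕ) : ℤ)) → kpow (mker U fun _ => m) n 0 x = 0 := by
  refine ⟨∑ s ∈ U, ∑ i, (s i).natAbs, fun n => ?_⟩
  set R := ∑ s ∈ U, ∑ i, (s i).natAbs with hR
  have hU : ∀ s ∈ U, ∀ i, |s i| ≤ (R : ℤ) := by
    intro s hs i
    have h1 : (s i).natAbs ≤ ∑ i, (s i).natAbs :=
      Finset.single_le_sum (f := fun i => (s i).natAbs) (fun _ _ => Nat.zero_le _)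
        (Finset.mem_univ i)
    have h2 : ∑ i, (s i).natAbs ≤ R :=
      Finset.single_le_sum (f := fun s : Zd d => ∑ i, (s i).natAbs) (fun _ _ => Nat.zero_le _) hs
    rw [Int.abs_eq_natAbs]
    exact_mod_cast h1.trans h2
  induction n with
  | zero =>
    intro x hx
    have : (0 : Zd d) ≠ x := by
      rintro rfl
      exact hx (by simp; rfl)
    simp [kpow, this]
  | succ n ih =>
    intro x hx
    simp only [kpow, ENNReal.tsum_eq_zero]
    intro z
    by_cases hz : z ∈ Finset.Icc (fun _ => -((R * n : ℕ) : ℤ)) (fun _ => ((R * n : ℕ) : ℤ))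
    · have hxz : x - z ∉ U := by
        intro hxz
        apply hx
        rw [Finset.mem_Icc] at hz ⊢
        constructor <;> intro i <;>
        · have h1 := abs_le.1 (hU _ hxz i)
          have h2 := hz.1 i
          have h3 := hz.2 i
          simp only [Pi.sub_apply] at h1
          push_cast at h2 h3 ⊢
          linarith [h1.1, h1.2]
      simp [mker, hxz]
    · rw [ih z hz, zero_mul]

lemma kpow_homogeneous_ne_top (hm : ∀ s, 0 ≤ m s) (n : ℕ) (x : Zd d) :
    kpow (mker U fun _ => m) n 0 x ≠ ∞ := by
  have h := tsum_kpow_homogeneous_mul_exp U m hm 0 n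
  have h1 := ENNReal.ne_top_of_tsum_ne_top
    (h.trans_ne (ENNReal.pow_ne_top ENNReal.ofReal_ne_top)) x
  simpa [zdot] using h1

/-- At each time and for each exponential tilt there is a point carrying at least the average of
the tilted mass. -/
lemma exists_le_zdot_add_log_kpow (hm : ∀ s, 0 ≤ m s) {l : ℝ} (hl : 0 < l)
    (h : ∀ θ, l ≤ phi U θ m) {n : ℕ} {B : Finset (Zd d)}
    (hB : ∀ x ∉ B, kpow (mker U fun _ => m) n 0 x = 0) {C : ℝ} (hC : (B.card : ℝ) ≤ Real.exp C)
    (θ : Fin d → ℝ) :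
    ∃ x ∈ B, kpow (mker U fun _ => m) n 0 x ≠ 0 ∧
      n * Real.log l - C ≤ zdot θ x + Real.log (kpow (mker U fun _ => m) n 0 x).toReal := by
  have hsum : ∑ x ∈ B, (kpow (mker U fun _ => m) n 0 x).toReal * Real.exp (zdot θ x) =
      phi U θ m ^ n := by
    have h1 := tsum_kpow_homogeneous_mul_exp U m hm θ n
    rw [tsum_eq_sum (s := B) (fun x hx => by rw [hB x hx, zero_mul])] at h1
    have h2 := congrArg ENNReal.toReal h1
    rw [ENNReal.toReal_sum fun x _ => ENNReal.mul_ne_top (kpow_homogeneous_ne_top U m hm n x)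
      ENNReal.ofReal_ne_top] at h2
    simpa [ENNReal.toReal_mul, ENNReal.toReal_ofReal (Real.exp_nonneg _),
      ENNReal.toReal_ofReal (hl.le.trans (h θ))] using h2
  have hpow : 0 < l ^ n := pow_pos hl n
  have hle : ∑ _x ∈ B, l ^ n * Real.exp (-C) ≤
      ∑ x ∈ B, (kpow (mker U fun _ => m) n 0 x).toReal * Real.exp (zdot θ x) := by
    rw [hsum, Finset.sum_const, nsmul_eq_mul]
    calc (B.card : ℝ) * (l ^ n * Real.exp (-C)) ≤ Real.exp C * (l ^ n * Real.exp (-C)) := by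
          gcongr
      _ = l ^ n * (Real.exp C * Real.exp (-C)) := by ring
      _ = l ^ n := by rw [← Real.exp_add, add_neg_cancel, Real.exp_zero, mul_one]
      _ ≤ phi U θ m ^ n := by gcongr; exact h θ
  have hBne : B.Nonempty := by
    rw [Finset.nonempty_iff_ne_empty]
    rintro rfl
    rw [Finset.sum_empty] at hsum
    exact (pow_pos (hl.trans_le (h θ)) n).ne hsum
  obtain ⟨x, hxB, hx⟩ := Finset.exists_le_of_sum_le hBne hle
  have hpos : 0 < l ^ n * Real.exp (-C) := mul_pos hpow (Real.exp_pos _)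
  have ha : 0 < (kpow (mker U fun _ => m) n 0 x).toReal :=
    pos_of_mul_pos_left (hpos.trans_le hx) (Real.exp_nonneg _)
  refine ⟨x, hxB, fun h0 => by simp [h0] at ha, ?_⟩
  have hlog := Real.log_le_log hpos hx
  rw [Real.log_mul hpow.ne' (Real.exp_ne_zero _), Real.log_mul ha.ne' (Real.exp_ne_zero _),
    Real.log_exp, Real.log_exp, Real.log_pow] at hlog
  linarith

lemma exp_div_le_rhoAt_homogeneous (hm : ∀ s, 0 ≤ m s) {l : ℝ} (hl : 0 < l)
    (h : ∀ θ, l ≤ phi U θ m) {n : ℕ} (hn : 0 < n) {B : Finset (Zd d)}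
    (hB : ∀ x ∉ B, kpow (mker U fun _ => m) n 0 x = 0) {C : ℝ}
    (hC : (B.card : ℝ) ≤ Real.exp C) :
    ENNReal.ofReal (Real.exp ((n * Real.log l - C - 1) / n)) ≤
      rhoAt (mker U fun _ => m) 0 0 := by
  classical
  set a := fun x => kpow (mker U fun _ => m) n 0 x with ha
  let T := B.filter fun x => a x ≠ 0
  set L' := n * Real.log l - C - 1 with hL'
  have hapos : ∀ x : T, 0 < (a x).toReal := fun x =>
    ENNReal.toReal_pos (Finset.mem_filter.1 x.2).2 (kpow_homogeneous_ne_top U m hm n x)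
  obtain ⟨N, hN0, hN⟩ := exists_nat_relation_of_forall_exists_le (fun x : T => (x : Zd d))
    (fun x => Real.log (a x).toReal) (L := n * Real.log l - C) (L' := L')
    (fun θ => by
      obtain ⟨x, hxB, hx0, hx⟩ := exists_le_zdot_add_log_kpow U m hm hl h hB hC θ
      exact ⟨⟨x, Finset.mem_filter.2 ⟨hxB, hx0⟩⟩, hx⟩) (by linarith)
  set Q := ∑ x, N x with hQ
  have hQpos : 0 < Q := by
    rw [Nat.pos_iff_ne_zero]
    intro hQ0
    rw [hQ, Finset.sum_eq_zero_iff] at hQ0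
    simp [fun x => hQ0 x (Finset.mem_univ x)] at hN
  have hlower : ENNReal.ofReal (Real.exp (L' * Q)) ≤ kpow (mker U fun _ => m) (n * Q) 0 0 := by
    have hprod := prod_pow_kpow_homogeneous_le U m n (fun x : T => (x : Zd d)) N Finset.univ
    rw [hN0] at hprod
    refine le_trans ?_ hprod
    have hfac : ∀ x : T, kpow (mker U fun _ => m) n 0 (x : Zd d) ^ N x =
        ENNReal.ofReal (Real.exp (N x * Real.log (a x).toReal)) := by
      intro x
      rw [Real.exp_nat_mul, Real.exp_log (hapos x), ENNReal.ofReal_pow ENNReal.toReal_nonneg,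
        ENNReal.ofReal_toReal (kpow_homogeneous_ne_top U m hm n x)]
    rw [Finset.prod_congr rfl fun x _ => hfac x,
      ← ENNReal.ofReal_prod_of_nonneg fun x _ => Real.exp_nonneg _, ← Real.exp_sum]
    refine ENNReal.ofReal_le_ofReal (Real.exp_le_exp.2 ?_)
    simp only [mul_sub, Finset.sum_sub_distrib, ← Finset.sum_mul] at hN
    rw [hQ]
    push_cast
    linarith
  refine le_rhoAt_of_pow_le _ _ _ (Nat.mul_pos hn hQpos) fun j => ?_
  have hn0 : (n : ℝ) ≠ 0 := by positivity
  have hpow := pow_kpow_homogeneous_le U m (n * Q) 0 j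
  rw [smul_zero] at hpow
  refine le_trans ?_ hpow
  rw [pow_mul]
  gcongr
  refine le_trans (le_of_eq ?_) hlower
  rw [← ENNReal.ofReal_pow (Real.exp_nonneg _), ← Real.exp_nat_mul]
  congr 2
  push_cast
  field_simp

/-- The spectral radius of a homogeneous kernel is bounded below by any lower bound of its
exponential moments. -/
lemma ofReal_le_rhoAt_homogeneous (hm : ∀ s, 0 ≤ m s) {l : ℝ} (h : ∀ θ, l ≤ phi U θ m) :
    ENNReal.ofReal l ≤ rhoAt (mker U fun _ => m) 0 0 := by
  rcases le_or_gt l 0 with hl | hl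
  · simp [ENNReal.ofReal_of_nonpos hl]
  obtain ⟨R, hR⟩ := exists_kpow_homogeneous_eq_zero U m
  let C : ℕ → ℝ := fun n => d * (Real.log (2 * R + 1) + Real.log n)
  have hstep : ∀ n : ℕ, 0 < n → ENNReal.ofReal
      (Real.exp ((n * Real.log l - C n - 1) / n)) ≤ rhoAt (mker U fun _ => m) 0 0 := by
    intro n hn
    refine exp_div_le_rhoAt_homogeneous U m hm hl h hn (hR n) ?_
    have hn' : (0 : ℝ) < n := by positivity
    have hcard : (Finset.Icc (fun _ => -((R * n : ℕ) : ℤ) : Zd d)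
        (fun _ => ((R * n : ℕ) : ℤ))).card = (2 * (R * n) + 1) ^ d := by
      rw [Pi.card_Icc]
      simp only [Int.card_Icc, Finset.prod_const, Finset.card_univ, Fintype.card_fin]
      congr 1
      omega
    simp only [C]
    rw [hcard, ← Real.log_mul (by positivity) hn'.ne', Real.exp_nat_mul,
      Real.exp_log (by positivity)]
    have : (1 : ℝ) ≤ n := by exact_mod_cast hn
    push_cast
    gcongr
    nlinarith
  have hlog : Tendsto (fun n : ℕ => Real.log n / n) atTop (nhds 0) := by
    simpa [Function.comp_def] using (Real.tendsto_pow_log_div_mul_add_atTop 1 0 1 one_ne_zero).comp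
      tendsto_natCast_atTop_atTop
  have hinv : Tendsto (fun n : ℕ => (1 : ℝ) / n) atTop (nhds 0) :=
    tendsto_one_div_atTop_nhds_zero_nat
  have hlim : Tendsto (fun n : ℕ => (n * Real.log l - C n - 1) / n) atTop (nhds (Real.log l)) := by
    have h1 : Tendsto (fun n : ℕ => Real.log l - d * Real.log (2 * R + 1) * ((1 : ℝ) / n) -
        d * (Real.log n / n) - 1 / n) atTop
        (nhds (Real.log l - d * Real.log (2 * R + 1) * 0 - d * 0 - 0)) :=
      ((tendsto_const_nhds.sub (hinv.const_mul _)).sub (hlog.const_mul _)).sub hinv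
    simp only [mul_zero, sub_zero] at h1
    refine h1.congr' ?_
    filter_upwards [eventually_gt_atTop 0] with n hn
    have hn0 : (n : ℝ) ≠ 0 := by positivity
    simp only [C]
    field_simp
    ring
  have hlim' := (ENNReal.continuous_ofReal.tendsto _).comp
    ((Real.continuous_exp.tendsto _).comp hlim)
  rw [Real.exp_log hl] at hlim'
  refine le_of_tendsto hlim' ?_
  filter_upwards [eventually_gt_atTop 0] with n hn using hstep n hn

end Homogeneous

lemma convexOn_phi {d : ℕ} (U : Finset (Zd d)) (m : ↥U → ℝ) (hm : ∀ s, 0 ≤ m s) :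
    ConvexOn ℝ Set.univ fun θ => phi U θ m := by
  refine ⟨convex_univ, fun x _ y _ a b ha hb hab => ?_⟩
  simp only [phi, smul_eq_mul, Finset.mul_sum, ← Finset.sum_add_distrib]
  refine Finset.sum_le_sum fun s _ => ?_
  have hexp := convexOn_exp.2 (Set.mem_univ (zdot x s)) (Set.mem_univ (zdot y s)) ha hb hab
  simp only [smul_eq_mul] at hexp
  rw [zdot_smul_add_smul]
  calc _ ≤ (a * Real.exp (zdot x s) + b * Real.exp (zdot y s)) * m s :=
        mul_le_mul_of_nonneg_right hexp (hm s)
    _ = _ := by ring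

/-- The minimax identity for exponential moments over a compact convex set of weights. -/
lemma iInf_iSup_phi_le {d : ℕ} (U : Finset (Zd d)) {X : Set (↥U → ℝ)} (hX : Convex ℝ X)
    (hcomp : IsCompact X) (hpos : ∀ m ∈ X, ∀ s, 0 ≤ m s) :
    (⨅ θ : Fin d → ℝ, ⨆ m ∈ X, ENNReal.ofReal (phi U θ m)) ≤
      ⨆ m ∈ X, ⨅ θ : Fin d → ℝ, ENNReal.ofReal (phi U θ m) := by
  refine le_of_forall_lt fun a ha => ?_
  obtain ⟨t', hat', ht'⟩ := ENNReal.lt_iff_exists_nnreal_btwn.1 ha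
  obtain ⟨t, htt', ht⟩ := ENNReal.lt_iff_exists_nnreal_btwn.1 ht'
  have hex : ∀ θ, ∃ m ∈ X, (t : ℝ) ≤ phi U θ m := by
    intro θ
    have h1 := ht.trans_le (iInf_le _ θ)
    simp only [lt_iSup_iff] at h1
    obtain ⟨m, hm, h2⟩ := h1
    refine ⟨m, hm, le_of_not_gt fun h3 => h2.not_ge ?_⟩
    rw [← ENNReal.ofReal_coe_nnreal]
    exact ENNReal.ofReal_le_ofReal h3.le
  obtain ⟨m₀, hm₀, -⟩ := hex 0
  obtain ⟨m, hm, hmt⟩ := exists_forall_lt_of_forall_exists_le (f := fun m θ => phi U θ m)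
    ⟨m₀, hm₀⟩ hX hcomp (fun θ => by unfold phi; fun_prop)
    (fun m => by unfold phi zdot; fun_prop)
    (fun θ => ⟨hX, fun x _ y _ a b _ _ _ => le_of_eq <| by
      simp only [phi, smul_eq_mul, Finset.mul_sum, ← Finset.sum_add_distrib]
      exact Finset.sum_congr rfl fun i _ => by simp; ring⟩)
    (fun m hm => convexOn_phi U m (hpos m hm)) hex (t' := t') (by exact_mod_cast htt')
  refine hat'.trans_le (le_iSup₂_of_le m hm (le_iInf fun θ => ?_))
  rw [← ENNReal.ofReal_coe_nnreal]
  exact ENNReal.ofReal_le_ofReal (hmt θ).le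

/-- The supremum of the spectral radii over environments with values in the convex hull `K̂`
equals the supremum of the spectral radii of the homogeneous kernels `M^h_m`, `m ∈ K̂`, which
in turn equals `sup_{m ∈ K̂} inf_θ Σ_{s ∈ U} e^{⟨θ,s⟩} m(s)`. -/
theorem sup_rho_eq_sup_homogeneous {d : ℕ} (hd : 1 ≤ d) (U : Finset (Zd d))
    (hUgen : AddSubgroup.closure (U : Set (Zd d)) = ⊤)
    (K : Set (↥U → ℝ)) (hKcomp : IsCompact K) (hKpos : ∀ m ∈ K, ∀ s, 0 ≤ m s)
    (ε : ℝ) (hε : 0 < ε) (S : Finset (Zd d)) (hSU : S ⊆ U)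
    (hSgen : AddSubgroup.closure (S : Set (Zd d)) = ⊤)
    (hKS : ∀ m ∈ K, ∀ s (hs : s ∈ S), ε ≤ m ⟨s, hSU hs⟩) :
    (⨆ (σ : Zd d → ↥U → ℝ) (_ : ∀ z : Zd d, σ z ∈ convexHull ℝ K),
        rhoAt (mker U σ) 0 0) =
      (⨆ m ∈ convexHull ℝ K, rhoAt (mker U (fun _ => m)) 0 0) ∧
    (⨆ m ∈ convexHull ℝ K, rhoAt (mker U (fun _ => m)) 0 0) =
      ⨆ m ∈ convexHull ℝ K, ⨅ θ : Fin d → ℝ, ENNReal.ofReal (phi U θ m) := by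
  have hcomp := isCompact_convexHull_of_isCompact hKcomp
  have hpos : ∀ m ∈ convexHull ℝ K, ∀ s, 0 ≤ m s := fun m hm =>
    convexHull_min (t := Set.Ici 0) (fun m hm => hKpos m hm) (convex_Ici 0) hm
  have hupper : (⨆ (σ : Zd d → ↥U → ℝ) (_ : ∀ z : Zd d, σ z ∈ convexHull ℝ K),
      rhoAt (mker U σ) 0 0) ≤
      ⨆ m ∈ convexHull ℝ K, ⨅ θ : Fin d → ℝ, ENNReal.ofReal (phi U θ m) := by
    refine (iSup₂_le fun σ hσ => le_iInf fun θ => ?_).trans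
      (iInf_iSup_phi_le U (convex_convexHull ℝ K) hcomp hpos)
    refine rhoAt_le_of_superharmonic _ (fun y => ENNReal.ofReal (Real.exp (zdot θ y))) _
      (fun z => ?_) 0 (by simp [Real.exp_pos]) ENNReal.ofReal_ne_top
    rw [tsum_mker_mul_exp U σ θ z (hpos _ (hσ z)), mul_comm]
    gcongr
    exact le_iSup₂ (f := fun m (_ : m ∈ convexHull ℝ K) => ENNReal.ofReal (phi U θ m)) _ (hσ z)
  have hlower : (⨆ m ∈ convexHull ℝ K, ⨅ θ : Fin d → ℝ, ENNReal.ofReal (phi U θ m)) ≤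
      ⨆ m ∈ convexHull ℝ K, rhoAt (mker U (fun _ => m)) 0 0 := by
    refine iSup₂_mono fun m hm => le_of_forall_lt fun a ha => ?_
    obtain ⟨t, hat, ht⟩ := ENNReal.lt_iff_exists_nnreal_btwn.1 ha
    refine hat.trans_le ?_
    rw [← ENNReal.ofReal_coe_nnreal]
    refine ofReal_le_rhoAt_homogeneous U m (hpos m hm) fun θ => ?_
    refine le_of_not_gt fun h => (ht.trans_le (iInf_le _ θ)).not_ge ?_
    rw [← ENNReal.ofReal_coe_nnreal]
    exact ENNReal.ofReal_le_ofReal h.le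
  have hconst : (⨆ m ∈ convexHull ℝ K, rhoAt (mker U (fun _ => m)) 0 0) ≤
      ⨆ (σ : Zd d → ↥U → ℝ) (_ : ∀ z : Zd d, σ z ∈ convexHull ℝ K), rhoAt (mker U σ) 0 0 :=
    iSup₂_le fun m hm => le_iSup₂_of_le (fun _ => m) (fun _ => hm) le_rfl
  exact ⟨le_antisymm (hupper.trans hlower) hconst, le_antisymm (hconst.trans hupper) hlower⟩
end
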